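/- arXiv:2506.04825 — 14 statements merged into one kernel-verified Lean document; each statement's English description precedes it below -/
import Mathlib

section
/- Let (Y,Y') be the Markov product of (X,Y). If X and Y are independent, then Y and Y' are independent. -/
open MeasureTheory ProbabilityTheory Set

/-- `Y'` is a conditionally independent copy of `Y` given `X`:
the conditional distribution of `Y'` given `X = x` equals the conditional distribution of `Y`
given `X = x` for `ℙ^X`-almost all `x`, and `Y` and `Y'` are conditionally independent
given `X`.  The pair `(Y, Y')` is then called the Markov product of `(X, Y)`. -/
def IsCondIndepCopy {Ω E : Type*} [MeasurableSpace Ω] [StandardBorelSpace Ω] [Nonempty Ω]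
    [MeasurableSpace E] (μ : Measure Ω) [IsFiniteMeasure μ]
    (X : Ω → E) (hX : Measurable X) (Y Y' : Ω → ℝ) : Prop :=
  (∀ᵐ x ∂(μ.map X), condDistrib Y' X μ x = condDistrib Y X μ x) ∧
  CondIndepFun (MeasurableSpace.comap X inferInstance) hX.comap_le Y Y' μ

/-- If `X` and `Y` are independent, then `Y` and its conditionally independent copy `Y'`
given `X` are independent. -/
theorem indep_of_indep {Ω : Type*} [MeasurableSpace Ω] [StandardBorelSpace Ω] [Nonempty Ω]
    {p : ℕ} (μ : Measure Ω) [IsProbabilityMeasure μ]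
    (X : Ω → (Fin p → ℝ)) (Y Y' : Ω → ℝ)
    (hX : Measurable X) (hY : Measurable Y) (hY' : Measurable Y')
    (hcopy : IsCondIndepCopy μ X hX Y Y')
    (hindep : IndepFun X Y μ) :
    IndepFun Y Y' μ := by
  rw [indepFun_iff_measure_inter_preimage_eq_mul]
  intro s t hs ht
  have h1 := (condIndepFun_iff_condExp_inter_preimage_eq_mul hY hY').1 hcopy.2 s t hs ht
  have h2 : μ[(Y ⁻¹' s).indicator (fun _ => (1 : ℝ)) | MeasurableSpace.comap X inferInstance]
      =ᵐ[μ] fun _ => μ[(Y ⁻¹' s).indicator (fun _ => (1 : ℝ))] := by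
    refine condExp_indep_eq (m₁ := MeasurableSpace.comap Y inferInstance) hY.comap_le hX.comap_le
      ?_ ?_
    · exact stronglyMeasurable_const.indicator ⟨s, hs, rfl⟩
    · exact (IndepFun_iff_Indep _ _ _).1 hindep.symm
  have ms : MeasurableSet (Y ⁻¹' s) := hY hs
  have mt : MeasurableSet (Y' ⁻¹' t) := hY' ht
  have h3 : μ.real (Y ⁻¹' s ∩ Y' ⁻¹' t) = μ.real (Y ⁻¹' s) * μ.real (Y' ⁻¹' t) := by
    have e : ∀ A : Set Ω, MeasurableSet A →
        μ.real A = ∫ ω, (μ[A.indicator (fun _ => (1 : ℝ)) |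
          MeasurableSpace.comap X inferInstance]) ω ∂μ := by
      intro A hA
      rw [integral_condExp hX.comap_le, integral_indicator_const _ hA]
      simp
    rw [e _ (ms.inter mt), e _ mt, ← integral_const_mul]
    refine integral_congr_ae ?_
    filter_upwards [h1, h2] with ω a b
    rw [a, b, integral_indicator_const _ ms]
    simp
  rw [← ENNReal.toReal_eq_toReal_iff' (by finiteness) (by finiteness), ENNReal.toReal_mul]
  exact h3
end

section
/- Let (Y,Y') be the Markov product of (X,Y). If Y and Y' are independent, then X and Y are independent. -/
open MeasureTheory ProbabilityTheory Set

/-- If `Y` and its conditionally independent copy `Y'` given `X` are independent,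
then `X` and `Y` are independent. -/
theorem indep_of_markov_indep {Ω : Type*} [MeasurableSpace Ω] [StandardBorelSpace Ω] [Nonempty Ω]
    {p : ℕ} (μ : Measure Ω) [IsProbabilityMeasure μ]
    (X : Ω → (Fin p → ℝ)) (Y Y' : Ω → ℝ)
    (hX : Measurable X) (hY : Measurable Y) (hY' : Measurable Y')
    (hcopy : IsCondIndepCopy μ X hX Y Y')
    (hindep : IndepFun Y Y' μ) :
    IndepFun X Y μ := by
  obtain ⟨h1, h2⟩ := hcopy
  rw [condIndepFun_iff_condExp_inter_preimage_eq_mul hY hY'] at h2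
  rw [indepFun_iff_measure_inter_preimage_eq_mul] at hindep ⊢
  intro A B hA hB
  have e1 := condDistrib_ae_eq_condExp (μ := μ) hX hY hB
  have e2 := condDistrib_ae_eq_condExp (μ := μ) hX hY' hB
  have h2' := h2 B B hB hB
  have hi := hindep B B hB hB
  have h1' := ae_of_ae_map hX.aemeasurable h1
  have mB := hY hB
  have mB' := hY' hB
  have i1 := integral_condExp (μ := μ) (f := (Y ⁻¹' B).indicator fun _ => (1:ℝ)) hX.comap_le
  have i2 := integral_condExp (μ := μ) (f := (Y' ⁻¹' B).indicator fun _ => (1:ℝ)) hX.comap_le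
  have i3 := integral_condExp (μ := μ) (f := (Y ⁻¹' B ∩ Y' ⁻¹' B).indicator fun _ => (1:ℝ)) hX.comap_le
  have i4 := setIntegral_condExp (μ := μ) (f := (Y ⁻¹' B).indicator fun _ => (1:ℝ)) hX.comap_le
    ((integrable_const _).indicator mB) (s := X ⁻¹' A) ⟨A, hA, rfl⟩
  rw [integral_indicator_const _ mB] at i1
  rw [integral_indicator_const _ mB'] at i2
  rw [integral_indicator_const _ (mB.inter mB')] at i3
  rw [setIntegral_indicator mB, setIntegral_const] at i4
  simp only [smul_eq_mul, mul_one] at i1 i2 i3 i4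
  have ff : μ[(Y' ⁻¹' B).indicator (fun _ => (1:ℝ)) | MeasurableSpace.comap X inferInstance] =ᵐ[μ] μ[(Y ⁻¹' B).indicator (fun _ => (1:ℝ)) | MeasurableSpace.comap X inferInstance] := by
    filter_upwards [e1, e2, h1'] with ω a b c
    rw [← a, ← b]
    simp only [Measure.real, c]
  have I : Integrable (μ[(Y ⁻¹' B).indicator (fun _ => (1:ℝ)) | MeasurableSpace.comap X inferInstance]) μ := integrable_condExp
  have I2 : Integrable (μ[(Y ⁻¹' B ∩ Y' ⁻¹' B).indicator (fun _ => (1:ℝ)) | MeasurableSpace.comap X inferInstance]) μ := integrable_condExp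
  rw [integral_congr_ae ff] at i2
  have hr : μ.real (Y ⁻¹' B ∩ Y' ⁻¹' B) = μ.real (Y ⁻¹' B) * μ.real (Y' ⁻¹' B) := by
    simp only [Measure.real, hi, ENNReal.toReal_mul]
  have hc : μ.real (Y' ⁻¹' B) = μ.real (Y ⁻¹' B) := by rw [← i1, ← i2]
  rw [hc] at hr
  set f := μ[(Y ⁻¹' B).indicator (fun _ => (1:ℝ)) | MeasurableSpace.comap X inferInstance] with hf
  set g := μ[(Y ⁻¹' B ∩ Y' ⁻¹' B).indicator (fun _ => (1:ℝ)) | MeasurableSpace.comap X inferInstance] with hg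
  set c := μ.real (Y ⁻¹' B) with hcdef
  have key : (fun ω => (f ω - c) ^ 2) =ᵐ[μ] fun ω => g ω - 2 * c * f ω + c ^ 2 := by
    filter_upwards [h2', ff] with ω a b
    simp only [b] at a
    change g ω = f ω * f ω at a
    rw [a]; ring
  have J1 : Integrable (fun ω => g ω - 2 * c * f ω) μ := I2.sub (I.const_mul _)
  have J : Integrable (fun ω => g ω - 2 * c * f ω + c ^ 2) μ := J1.add (integrable_const _)
  have z : ∫ ω, (f ω - c) ^ 2 ∂μ = 0 := by
    rw [integral_congr_ae key, integral_add J1 (integrable_const _),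
      integral_sub I2 (I.const_mul _), integral_const_mul, i1, i3, hr]
    simp
    ring
  rw [integral_eq_zero_iff_of_nonneg (fun ω => sq_nonneg _) (J.congr key.symm)] at z
  have fc : f =ᵐ[μ] fun _ => c := by
    filter_upwards [z] with ω h
    have : (f ω - c) ^ 2 = 0 := h
    nlinarith [pow_eq_zero_iff (two_ne_zero) |>.1 this]
  rw [setIntegral_congr_ae (hX hA) (fc.mono fun _ h _ => h), setIntegral_const, smul_eq_mul] at i4
  have : (μ (X ⁻¹' A ∩ Y ⁻¹' B)).toReal = (μ (X ⁻¹' A) * μ (Y ⁻¹' B)).toReal := by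
    rw [ENNReal.toReal_mul]; simpa [Measure.real, hcdef] using i4.symm
  exact (ENNReal.toReal_eq_toReal_iff' (by finiteness) (by finiteness)).1 this
end

section
/- Let Y and at least one coordinate of X be non-degenerate, let (Y,Y') be the Markov product of (X,Y), and let (Y₁,Y₁') and (Y₂,Y₂') be independent copies of (Y,Y'). Then Y is stochastically comparable relative to X if and only if the probability of concordance of (Y,Y') equals its probability of discordance, i.e. ℙ((Y₁−Y₂)(Y₁'−Y₂') > 0) = ℙ((Y₁−Y₂)(Y₁'−Y₂') < 0). -/
open MeasureTheory ProbabilityTheory Set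

/-- The relative effect `Ψ(μ, ν) = ∫ μ((−∞,z)) + ½ μ({z}) dν(z)` of two
probability measures on `ℝ`. -/
noncomputable def relEffect (μ ν : Measure ℝ) : ℝ :=
  ∫ z, (μ (Set.Iio z)).toReal + (1 / 2) * (μ {z}).toReal ∂ν

/-- `Y` is stochastically comparable relative to `X` if
`Ψ(ℙ^{Y|X=x₁}, ℙ^{Y|X=x₂}) = 1/2` for `(ℙ^X ⊗ ℙ^X)`-almost all `(x₁, x₂)` with `x₁ ≠ x₂`. -/
def StochasticallyComparable {Ω E : Type*} [MeasurableSpace Ω] [MeasurableSpace E]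
    (μ : Measure Ω) [IsFiniteMeasure μ] (X : Ω → E) (Y : Ω → ℝ) : Prop :=
  ∀ᵐ q ∂((μ.map X).prod (μ.map X)), q.1 ≠ q.2 →
    relEffect (condDistrib Y X μ q.1) (condDistrib Y X μ q.2) = 1 / 2

lemma aux_rearr (a b : Measure ℝ) [IsProbabilityMeasure a] [IsProbabilityMeasure b]
    {A B : Set (ℝ × ℝ)} (hA : MeasurableSet A) (hB : MeasurableSet B) :
    ((a.prod a).prod (b.prod b)) {w | (w.1.1, w.2.1) ∈ A ∧ (w.1.2, w.2.2) ∈ B}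
      = (a.prod b) A * (a.prod b) B := by
  have hfA : Measurable (A.indicator (1 : ℝ × ℝ → ENNReal)) := measurable_one.indicator hA
  have hfB : Measurable (B.indicator (1 : ℝ × ℝ → ENNReal)) := measurable_one.indicator hB
  have hS : MeasurableSet {w : (ℝ × ℝ) × (ℝ × ℝ) | (w.1.1, w.2.1) ∈ A ∧ (w.1.2, w.2.2) ∈ B} :=
    MeasurableSet.inter (hA.preimage (by fun_prop)) (hB.preimage (by fun_prop))
  rw [Measure.prod_apply hS]
  have h1 : ∀ z : ℝ × ℝ, (b.prod b) (Prod.mk z ⁻¹'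
      {w : (ℝ × ℝ) × (ℝ × ℝ) | (w.1.1, w.2.1) ∈ A ∧ (w.1.2, w.2.2) ∈ B})
      = b (Prod.mk z.1 ⁻¹' A) * b (Prod.mk z.2 ⁻¹' B) := by
    intro z
    rw [← Measure.prod_prod]
    rfl
  simp_rw [h1]
  rw [Measure.prod_apply hA, Measure.prod_apply hB]
  exact lintegral_prod_mul (measurable_measure_prodMk_left hA).aemeasurable
    (measurable_measure_prodMk_left hB).aemeasurable

lemma aux_relEffect (a b : Measure ℝ) [IsProbabilityMeasure a] [IsProbabilityMeasure b] :
    relEffect a b = 1 / 2 ↔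
      ((a.prod b) {q | q.1 < q.2}).toReal = ((a.prod b) {q | q.2 < q.1}).toReal := by
  have mL : MeasurableSet {q : ℝ × ℝ | q.1 < q.2} := measurableSet_lt measurable_fst measurable_snd
  have mG : MeasurableSet {q : ℝ × ℝ | q.2 < q.1} := measurableSet_lt measurable_snd measurable_fst
  have mE : MeasurableSet {q : ℝ × ℝ | q.1 = q.2} :=
    measurableSet_eq_fun measurable_fst measurable_snd
  have eL : ∀ z : ℝ, (fun x => (x, z)) ⁻¹' {q : ℝ × ℝ | q.1 < q.2} = Iio z := fun z => by
    ext x; simp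
  have eE : ∀ z : ℝ, (fun x => (x, z)) ⁻¹' {q : ℝ × ℝ | q.1 = q.2} = {z} := fun z => by
    ext x; simp
  have m1 : Measurable fun z => a (Iio z) := by
    simpa [eL] using measurable_measure_prodMk_right (μ := a) mL
  have m2 : Measurable fun z => a {z} := by
    simpa [eE] using measurable_measure_prodMk_right (μ := a) mE
  have i1 : Integrable (fun z => (a (Iio z)).toReal) b :=
    Integrable.of_bound m1.ennreal_toReal.aestronglyMeasurable 1
      (Filter.Eventually.of_forall fun z => by
        rw [Real.norm_of_nonneg ENNReal.toReal_nonneg]; exact measureReal_le_one)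
  have i2 : Integrable (fun z => (a {z}).toReal) b :=
    Integrable.of_bound m2.ennreal_toReal.aestronglyMeasurable 1
      (Filter.Eventually.of_forall fun z => by
        rw [Real.norm_of_nonneg ENNReal.toReal_nonneg]; exact measureReal_le_one)
  have h1 : ∫ z, (a (Iio z)).toReal ∂b = ((a.prod b) {q | q.1 < q.2}).toReal := by
    rw [integral_toReal m1.aemeasurable (Filter.Eventually.of_forall fun z => measure_lt_top _ _),
      Measure.prod_apply_symm mL]
    simp_rw [eL]
  have h2 : ∫ z, (a {z}).toReal ∂b = ((a.prod b) {q | q.1 = q.2}).toReal := by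
    rw [integral_toReal m2.aemeasurable (Filter.Eventually.of_forall fun z => measure_lt_top _ _),
      Measure.prod_apply_symm mE]
    simp_rw [eE]
  have hsum : ((a.prod b) {q | q.1 < q.2}).toReal + ((a.prod b) {q | q.1 = q.2}).toReal
      + ((a.prod b) {q | q.2 < q.1}).toReal = 1 := by
    change (a.prod b).real _ + (a.prod b).real _ + (a.prod b).real _ = 1
    have d1 : Disjoint {q : ℝ × ℝ | q.1 < q.2} {q : ℝ × ℝ | q.1 = q.2} := by
      rw [Set.disjoint_left]
      intro q h h'
      simp only [mem_ofPred_eq] at h h'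
      linarith
    have d2 : Disjoint ({q : ℝ × ℝ | q.1 < q.2} ∪ {q : ℝ × ℝ | q.1 = q.2})
        {q : ℝ × ℝ | q.2 < q.1} := by
      rw [Set.disjoint_left]
      intro q h h'
      simp only [mem_union, mem_ofPred_eq] at h h'
      rcases h with h | h <;> linarith
    rw [← measureReal_union d1 mE, ← measureReal_union d2 mG, ← probReal_univ (μ := a.prod b)]
    congr 1
    ext q
    rcases lt_trichotomy q.1 q.2 with h | h | h <;> simp [h]
  unfold relEffect
  rw [integral_add i1 (i2.const_mul _), integral_const_mul, h1, h2]
  constructor <;> intro h <;> linarith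

lemma aux_law {Ω Ω' E : Type*} [MeasurableSpace Ω] [StandardBorelSpace Ω] [Nonempty Ω]
    [MeasurableSpace Ω'] [MeasurableSpace E]
    (μ : Measure Ω) [IsProbabilityMeasure μ] (μ' : Measure Ω') [IsProbabilityMeasure μ']
    (X : Ω → E) (Y Y' : Ω → ℝ) (Y₁ Y₁' Y₂ Y₂' : Ω' → ℝ)
    (hX : Measurable X) (hY : Measurable Y) (hY' : Measurable Y')
    (hY₁ : Measurable Y₁) (hY₁' : Measurable Y₁') (hY₂ : Measurable Y₂) (hY₂' : Measurable Y₂')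
    (hcopy : IsCondIndepCopy μ X hX Y Y')
    (hcopy₁ : μ'.map (fun ω => (Y₁ ω, Y₁' ω)) = μ.map (fun ω => (Y ω, Y' ω)))
    (hcopy₂ : μ'.map (fun ω => (Y₂ ω, Y₂' ω)) = μ.map (fun ω => (Y ω, Y' ω)))
    (hindep : IndepFun (fun ω => (Y₁ ω, Y₁' ω)) (fun ω => (Y₂ ω, Y₂' ω)) μ')
    {A B : Set (ℝ × ℝ)} (hA : MeasurableSet A) (hB : MeasurableSet B) :
    μ' {ω | (Y₁ ω, Y₂ ω) ∈ A ∧ (Y₁' ω, Y₂' ω) ∈ B} =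
      ∫⁻ q, ((condDistrib Y X μ q.1).prod (condDistrib Y X μ q.2)) A *
        ((condDistrib Y X μ q.1).prod (condDistrib Y X μ q.2)) B
        ∂((μ.map X).prod (μ.map X)) := by
  have : IsProbabilityMeasure (μ.map X) := Measure.isProbabilityMeasure_map hX.aemeasurable
  obtain ⟨hae, hci⟩ := hcopy
  set κ := condDistrib Y X μ with hκ
  have h1 := (condIndepFun_iff_map_prod_eq_prod_condDistrib_prod_condDistrib hY hY' hX).1 hci
  have hπ : μ.map (fun ω => (Y ω, Y' ω)) = (κ ×ₖ κ) ∘ₘ μ.map X := by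
    have h2 := congrArg (fun m => m.map Prod.snd) h1
    rw [Measure.map_map measurable_snd (by fun_prop)] at h2
    have h3 : (Prod.snd ∘ fun ω => (X ω, Y ω, Y' ω)) = fun ω => (Y ω, Y' ω) := rfl
    rw [h3] at h2
    rw [h2, Measure.map_comp _ _ measurable_snd]
    refine Measure.bind_congr_right ?_
    filter_upwards [hae] with x hx
    rw [Kernel.map_apply _ measurable_snd, Kernel.prod_apply, Kernel.prod_apply, Kernel.prod_apply,
      Kernel.id_apply, hx, ← Measure.snd, Measure.snd_prod]
  have hlaw : μ'.map (fun ω => ((Y₁ ω, Y₁' ω), (Y₂ ω, Y₂' ω))) =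
      ((κ ×ₖ κ) ∥ₖ (κ ×ₖ κ)) ∘ₘ ((μ.map X).prod (μ.map X)) := by
    rw [hindep.map_prod_eq_prod_map_map (by fun_prop) (by fun_prop), hcopy₁, hcopy₂, hπ,
      Measure.prod_comp_left, Measure.prod_comp_right, Measure.comp_assoc,
      Kernel.parallelComp_comp_parallelComp]
    simp
  have hS : MeasurableSet {w : (ℝ × ℝ) × (ℝ × ℝ) | (w.1.1, w.2.1) ∈ A ∧ (w.1.2, w.2.2) ∈ B} :=
    MeasurableSet.inter (hA.preimage (by fun_prop)) (hB.preimage (by fun_prop))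
  have h4 := congrArg (fun m => m {w : (ℝ × ℝ) × (ℝ × ℝ) |
    (w.1.1, w.2.1) ∈ A ∧ (w.1.2, w.2.2) ∈ B}) hlaw
  rw [Measure.map_apply (by fun_prop) hS, Measure.bind_apply hS (Kernel.aemeasurable _)] at h4
  refine h4.trans (lintegral_congr fun q => ?_)
  rw [Kernel.parallelComp_apply, Kernel.prod_apply, Kernel.prod_apply, aux_rearr _ _ hA hB]

/-- Let `Y` and at least one coordinate of `X` be non-degenerate, `(Y, Y')` the Markov product
of `(X, Y)` and `(Y₁, Y₁')`, `(Y₂, Y₂')` independent copies of `(Y, Y')`.  Then `Y` is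
stochastically comparable relative to `X` iff the probability of concordance of `(Y, Y')`
equals its probability of discordance. -/
theorem stochastically_comparable_iff_concordance_eq_discordance
    {Ω Ω' : Type*} [MeasurableSpace Ω] [StandardBorelSpace Ω] [Nonempty Ω] [MeasurableSpace Ω']
    {p : ℕ} (μ : Measure Ω) [IsProbabilityMeasure μ] (μ' : Measure Ω') [IsProbabilityMeasure μ']
    (X : Ω → (Fin p → ℝ)) (Y Y' : Ω → ℝ) (Y₁ Y₁' Y₂ Y₂' : Ω' → ℝ)
    (hX : Measurable X) (hY : Measurable Y) (hY' : Measurable Y')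
    (hY₁ : Measurable Y₁) (hY₁' : Measurable Y₁') (hY₂ : Measurable Y₂) (hY₂' : Measurable Y₂')
    (hYnondeg : ¬ ∃ c : ℝ, Y =ᵐ[μ] fun _ => c)
    (hXnondeg : ∃ i : Fin p, ¬ ∃ c : ℝ, (fun ω => X ω i) =ᵐ[μ] fun _ => c)
    (hcopy : IsCondIndepCopy μ X hX Y Y')
    (hcopy₁ : μ'.map (fun ω => (Y₁ ω, Y₁' ω)) = μ.map (fun ω => (Y ω, Y' ω)))
    (hcopy₂ : μ'.map (fun ω => (Y₂ ω, Y₂' ω)) = μ.map (fun ω => (Y ω, Y' ω)))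
    (hindep : IndepFun (fun ω => (Y₁ ω, Y₁' ω)) (fun ω => (Y₂ ω, Y₂' ω)) μ') :
    StochasticallyComparable μ X Y
      ↔ μ' {ω | 0 < (Y₁ ω - Y₂ ω) * (Y₁' ω - Y₂' ω)}
          = μ' {ω | (Y₁ ω - Y₂ ω) * (Y₁' ω - Y₂' ω) < 0} := by
  have : IsProbabilityMeasure (μ.map X) := Measure.isProbabilityMeasure_map hX.aemeasurable
  have law {A B : Set (ℝ × ℝ)} (hA : MeasurableSet A) (hB : MeasurableSet B) :=
    aux_law μ μ' X Y Y' Y₁ Y₁' Y₂ Y₂' hX hY hY' hY₁ hY₁' hY₂ hY₂' hcopy hcopy₁ hcopy₂ hindep hA hB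
  have mL : MeasurableSet {q : ℝ × ℝ | q.1 < q.2} := measurableSet_lt measurable_fst measurable_snd
  have mG : MeasurableSet {q : ℝ × ℝ | q.2 < q.1} := measurableSet_lt measurable_snd measurable_fst
  have meas {A : Set (ℝ × ℝ)} (hA : MeasurableSet A) : Measurable fun q : (Fin p → ℝ) × (Fin p → ℝ) =>
      ((condDistrib Y X μ q.1).prod (condDistrib Y X μ q.2)) A := by
    have := Kernel.measurable_coe (condDistrib Y X μ ∥ₖ condDistrib Y X μ) hA
    simpa only [Kernel.parallelComp_apply] using this
  have hLm := meas mL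
  have hGm := meas mG
  set ν := (μ.map X).prod (μ.map X) with hν
  set L : (Fin p → ℝ) × (Fin p → ℝ) → ENNReal := fun q =>
    ((condDistrib Y X μ q.1).prod (condDistrib Y X μ q.2)) {q | q.1 < q.2} with hL
  set G : (Fin p → ℝ) × (Fin p → ℝ) → ENNReal := fun q =>
    ((condDistrib Y X μ q.1).prod (condDistrib Y X μ q.2)) {q | q.2 < q.1} with hG
  have hC : μ' {ω | 0 < (Y₁ ω - Y₂ ω) * (Y₁' ω - Y₂' ω)} = ∫⁻ q, L q * L q + G q * G q ∂ν := by
    rw [lintegral_add_left (by fun_prop), ← law mL mL, ← law mG mG, ← measure_union]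
    · congr 1
      ext ω
      simp only [mem_ofPred_eq, mem_union, mul_pos_iff, sub_pos, sub_neg]
      tauto
    · rw [Set.disjoint_left]
      intro ω h h'
      simp only [mem_ofPred_eq] at h h'
      linarith [h.1, h'.1]
    · exact ((mG.preimage (f := fun ω => (Y₁ ω, Y₂ ω)) (by fun_prop)).inter
        (mG.preimage (f := fun ω => (Y₁' ω, Y₂' ω)) (by fun_prop)))
  have hD : μ' {ω | (Y₁ ω - Y₂ ω) * (Y₁' ω - Y₂' ω) < 0} = ∫⁻ q, L q * G q + G q * L q ∂ν := by
    rw [lintegral_add_left (by fun_prop), ← law mL mG, ← law mG mL, ← measure_union]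
    · congr 1
      ext ω
      simp only [mem_ofPred_eq, mem_union, mul_neg_iff, sub_pos, sub_neg]
      tauto
    · rw [Set.disjoint_left]
      intro ω h h'
      simp only [mem_ofPred_eq] at h h'
      linarith [h.1, h'.1]
    · exact ((mG.preimage (f := fun ω => (Y₁ ω, Y₂ ω)) (by fun_prop)).inter
        (mL.preimage (f := fun ω => (Y₁' ω, Y₂' ω)) (by fun_prop)))
  have L1 : ∀ q, L q ≤ 1 := fun q => prob_le_one
  have G1 : ∀ q, G q ≤ 1 := fun q => prob_le_one
  have Lt : ∀ q, L q ≠ ⊤ := fun q => measure_ne_top _ _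
  have Gt : ∀ q, G q ≠ ⊤ := fun q => measure_ne_top _ _
  have hle : ∀ q, L q * G q + G q * L q ≤ L q * L q + G q * G q := by
    intro q
    lift L q to NNReal using Lt q with l
    lift G q to NNReal using Gt q with g
    norm_cast
    rw [← NNReal.coe_le_coe]
    push_cast
    nlinarith [sq_nonneg ((l : ℝ) - g)]
  have heq : ∀ q, L q * G q + G q * L q = L q * L q + G q * G q ↔ (L q).toReal = (G q).toReal := by
    intro q
    lift L q to NNReal using Lt q with l
    lift G q to NNReal using Gt q with g
    norm_cast
    rw [← NNReal.coe_inj, ENNReal.coe_toReal, ENNReal.coe_toReal]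
    push_cast
    constructor
    · intro h
      have : ((l : ℝ) - g) ^ 2 = 0 := by linarith
      exact sub_eq_zero.1 (pow_eq_zero_iff (two_ne_zero) |>.1 this)
    · intro h
      rw [h]
  have hfin : ∫⁻ q, L q * G q + G q * L q ∂ν ≠ ⊤ := by
    rw [← hD]
    exact measure_ne_top _ _
  have diag : ∀ x, (L (x, x)).toReal = (G (x, x)).toReal := by
    intro x
    congr 1
    simp only [hL, hG]
    conv_lhs => rw [← Measure.prod_swap]
    rw [Measure.map_apply measurable_swap mL]
    rfl
  rw [hC, hD]
  have key : StochasticallyComparable μ X Y ↔ ∀ᵐ q ∂ν, (L q).toReal = (G q).toReal := by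
    unfold StochasticallyComparable
    refine Filter.eventually_congr (Filter.Eventually.of_forall ?_)
    rintro ⟨x, y⟩
    rw [aux_relEffect]
    by_cases hxy : x = y
    · subst hxy
      simpa using diag x
    · simp only [ne_eq, hxy, not_false_eq_true, forall_const]
      rfl
  rw [key]
  constructor
  · intro h
    refine lintegral_congr_ae ?_
    filter_upwards [h] with q hq
    exact ((heq q).2 hq).symm
  · intro h
    have := ae_eq_of_ae_le_of_lintegral_le (Filter.Eventually.of_forall hle) hfin
      (by fun_prop) h.le
    filter_upwards [this] with q hq
    exact (heq q).1 hq
end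

section
/- Let (Y,Y') be the Markov product of (X,Y). If there exists a measurable function f with Y = f(X) almost surely, then Y and Y' are comonotone, i.e. ℙ(Y ≤ y, Y' ≤ y') = min{F_Y(y), F_{Y'}(y')} for all y, y' ∈ ℝ. -/
open MeasureTheory ProbabilityTheory Set

/-- If `Y` perfectly depends on `X`, i.e. `Y = f(X)` a.s. for a measurable `f`, then `Y` and
its conditionally independent copy `Y'` given `X` are comonotone:
`ℙ(Y ≤ y, Y' ≤ y') = min{F_Y(y), F_{Y'}(y')}` for all `y, y'`. -/
theorem comonotone_of_perfect_dependence {Ω : Type*} [MeasurableSpace Ω] [StandardBorelSpace Ω]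
    [Nonempty Ω] {p : ℕ} (μ : Measure Ω) [IsProbabilityMeasure μ]
    (X : Ω → (Fin p → ℝ)) (Y Y' : Ω → ℝ)
    (hX : Measurable X) (hY : Measurable Y) (hY' : Measurable Y')
    (hcopy : IsCondIndepCopy μ X hX Y Y')
    (hperfect : ∃ f : (Fin p → ℝ) → ℝ, Measurable f ∧ Y =ᵐ[μ] fun ω => f (X ω)) :
    ∀ y y' : ℝ, μ {ω | Y ω ≤ y ∧ Y' ω ≤ y'}
      = min (μ {ω | Y ω ≤ y}) (μ {ω | Y' ω ≤ y'}) := by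
  obtain ⟨f, hf, hYf⟩ := hperfect
  have hlaw : μ.map (fun ω => (X ω, Y' ω)) = μ.map (fun ω => (X ω, Y ω)) := by
    rw [← compProd_map_condDistrib hY'.aemeasurable, ← compProd_map_condDistrib hY.aemeasurable]
    exact Measure.compProd_congr hcopy.1
  have hS : MeasurableSet {q : (Fin p → ℝ) × ℝ | q.2 = f q.1} :=
    measurableSet_eq_fun measurable_snd (hf.comp measurable_fst)
  have h1 : ∀ᵐ q ∂(μ.map (fun ω => (X ω, Y ω))), q.2 = f q.1 :=
    (ae_map_iff (hX.prodMk hY).aemeasurable hS).2 hYf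
  rw [← hlaw] at h1
  have h2 : ∀ᵐ ω ∂μ, Y' ω = f (X ω) := (ae_map_iff (hX.prodMk hY').aemeasurable hS).1 h1
  have h3 : ∀ᵐ ω ∂μ, Y' ω = Y ω := by
    filter_upwards [h2, hYf] with ω a b
    rw [a, b]
  intro y y'
  have e1 : μ {ω | Y ω ≤ y ∧ Y' ω ≤ y'} = μ {ω | Y ω ≤ min y y'} := by
    apply measure_congr
    filter_upwards [h3] with ω h
    apply propext
    change (Y ω ≤ y ∧ Y' ω ≤ y') ↔ Y ω ≤ min y y'
    rw [h, le_min_iff]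
  have e2 : μ {ω | Y' ω ≤ y'} = μ {ω | Y ω ≤ y'} := by
    apply measure_congr
    filter_upwards [h3] with ω h
    apply propext
    change Y' ω ≤ y' ↔ Y ω ≤ y'
    rw [h]
  have hm : Monotone (fun t : ℝ => μ {ω | Y ω ≤ t}) := fun a b hab =>
    measure_mono fun ω (h : Y ω ≤ a) => h.trans hab
  rw [e1, e2]
  exact hm.map_min
end

section
/- Let (Y,Y') be the Markov product of (X,Y). If Y and Y' are comonotone, i.e. ℙ(Y ≤ y, Y' ≤ y') = min{F_Y(y), F_{Y'}(y')} for all y, y' ∈ ℝ, then Y perfectly depends on X, i.e. there exists a measurable function f with Y = f(X) almost surely. -/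
open MeasureTheory ProbabilityTheory Set

theorem aux_dirac (ν : Measure ℝ) [IsProbabilityMeasure ν]
    (h : ∀ q : ℚ, ν.real (Iic (q : ℝ)) = 0 ∨ ν.real (Iic (q : ℝ)) = 1) :
    ∃ a : ℝ, ∀ᵐ t ∂ν, t = a := by
  haveI : HasCountableSeparatingOn ℝ (fun s => ∃ q : ℚ, s = Iic (q : ℝ)) univ := by
    refine ⟨⟨range (fun q : ℚ => Iic (q : ℝ)), countable_range _, ?_, ?_⟩⟩
    · rintro s ⟨q, rfl⟩
      exact ⟨q, rfl⟩
    · intro x _ y _ hxy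
      by_contra hne
      rcases lt_or_gt_of_ne hne with hlt | hlt
      · obtain ⟨q, h1, h2⟩ := exists_rat_btwn hlt
        have := (hxy _ ⟨q, rfl⟩).1 h1.le
        exact absurd this (not_le.2 h2)
      · obtain ⟨q, h1, h2⟩ := exists_rat_btwn hlt
        have := (hxy _ ⟨q, rfl⟩).2 h1.le
        exact absurd this (not_le.2 h2)
  refine Filter.exists_eventuallyEq_const_of_forall_separating (l := ae ν) (f := fun t : ℝ => t)
    (fun s => ∃ q : ℚ, s = Iic (q : ℝ)) ?_
  rintro U ⟨q, rfl⟩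
  rcases h q with h0 | h1
  · right
    rw [measureReal_eq_zero_iff] at h0
    exact measure_eq_zero_iff_ae_notMem.1 h0
  · left
    have h2 : ν (Iic (q : ℝ)) = 1 := by
      rw [← ofReal_measureReal, h1, ENNReal.ofReal_one]
    exact (mem_ae_iff_prob_eq_one measurableSet_Iic).2 h2

/-- If `Y` and its conditionally independent copy `Y'` given `X` are comonotone, i.e.
`ℙ(Y ≤ y, Y' ≤ y') = min{F_Y(y), F_{Y'}(y')}` for all `y, y'`, then `Y` perfectly depends
on `X`: there is a measurable `f` with `Y = f(X)` almost surely. -/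
theorem perfect_dependence_of_comonotone {Ω : Type*} [MeasurableSpace Ω] [StandardBorelSpace Ω]
    [Nonempty Ω] {p : ℕ} (μ : Measure Ω) [IsProbabilityMeasure μ]
    (X : Ω → (Fin p → ℝ)) (Y Y' : Ω → ℝ)
    (hX : Measurable X) (hY : Measurable Y) (hY' : Measurable Y')
    (hcopy : IsCondIndepCopy μ X hX Y Y')
    (hcomon : ∀ y y' : ℝ, μ {ω | Y ω ≤ y ∧ Y' ω ≤ y'}
      = min (μ {ω | Y ω ≤ y}) (μ {ω | Y' ω ≤ y'})) :
    ∃ f : (Fin p → ℝ) → ℝ, Measurable f ∧ Y =ᵐ[μ] fun ω => f (X ω) := by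
  obtain ⟨hc, hi⟩ := hcopy
  have hc' : ∀ᵐ ω ∂μ, condDistrib Y' X μ (X ω) = condDistrib Y X μ (X ω) :=
    ae_of_ae_map hX.aemeasurable hc
  rw [condIndepFun_iff_condExp_inter_preimage_eq_mul hY hY'] at hi
  have key : ∀ q : ℚ, ∀ᵐ ω ∂μ, (condDistrib Y X μ (X ω)).real (Iic (q : ℝ)) = 0 ∨
      (condDistrib Y X μ (X ω)).real (Iic (q : ℝ)) = 1 := by
    intro q
    have hs : MeasurableSet (Iic (q : ℝ)) := measurableSet_Iic
    have h1 := condDistrib_ae_eq_condExp (μ := μ) hX hY hs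
    have h2 := condDistrib_ae_eq_condExp (μ := μ) hX hY' hs
    have h3 := hi _ _ hs hs
    set g : Ω → ℝ := fun ω => (condDistrib Y X μ (X ω)).real (Iic (q : ℝ)) with hg
    have hcE : ∀ s : Set Ω, MeasurableSet s →
        ∫ ω, (μ⟦s | MeasurableSpace.comap X inferInstance⟧) ω ∂μ = μ.real s := by
      intro s hs
      rw [integral_condExp hX.comap_le, integral_indicator_const _ hs]
      simp
    have e1 : ∫ ω, g ω ∂μ = μ.real (Y ⁻¹' Iic (q : ℝ)) := by
      rw [integral_congr_ae h1, hcE _ (hY hs)]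
    have e2 : ∫ ω, g ω ∂μ = μ.real (Y' ⁻¹' Iic (q : ℝ)) := by
      rw [← hcE _ (hY' hs), ← integral_congr_ae h2]
      refine integral_congr_ae ?_
      filter_upwards [hc'] with ω hω
      simp only [hg, hω]
    have h4 : μ⟦Y ⁻¹' Iic (q : ℝ) ∩ Y' ⁻¹' Iic (q : ℝ) |
        MeasurableSpace.comap X inferInstance⟧ =ᵐ[μ] fun ω => g ω * g ω := by
      filter_upwards [h1, h2, h3, hc'] with ω a1 a2 a3 a4
      rw [a3, ← a1, ← a2, a4]
    have e3 : ∫ ω, g ω * g ω ∂μ = μ.real (Y ⁻¹' Iic (q : ℝ) ∩ Y' ⁻¹' Iic (q : ℝ)) := by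
      rw [← integral_congr_ae h4, hcE _ ((hY hs).inter (hY' hs))]
    have e4 : μ.real (Y ⁻¹' Iic (q : ℝ) ∩ Y' ⁻¹' Iic (q : ℝ)) = μ.real (Y ⁻¹' Iic (q : ℝ)) := by
      have hm := hcomon q q
      have heq : μ {ω | Y ω ≤ q} = μ {ω | Y' ω ≤ q} := by
        rw [← measureReal_eq_measureReal_iff]
        exact e1.symm.trans e2
      rw [← heq, min_self] at hm
      exact congrArg ENNReal.toReal hm
    have i1 : Integrable g μ := integrable_condExp.congr h1.symm
    have i2 : Integrable (fun ω => g ω * g ω) μ := integrable_condExp.congr h4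
    have h0 : ∫ ω, (g ω - g ω * g ω) ∂μ = 0 := by
      rw [integral_sub i1 i2, e1, e3, e4, sub_self]
    have hnn : ∀ ω, 0 ≤ g ω - g ω * g ω := by
      intro ω
      have a : 0 ≤ g ω := measureReal_nonneg
      have b : g ω ≤ 1 := measureReal_le_one
      nlinarith
    rw [integral_eq_zero_iff_of_nonneg hnn (i1.sub i2)] at h0
    filter_upwards [h0] with ω hω
    have h5 : g ω * (1 - g ω) = 0 := by
      have : g ω - g ω * g ω = 0 := hω
      linarith
    rcases mul_eq_zero.1 h5 with h | h
    · exact Or.inl h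
    · right
      change g ω = 1
      linarith
  let f : (Fin p → ℝ) → ℝ := fun x => ∫ t, t ∂(condDistrib Y X μ x)
  have hf : Measurable f :=
    (StronglyMeasurable.integral_condDistrib (Y := Y) (X := X) (μ := μ)
      (f := fun z : (Fin p → ℝ) × ℝ => z.2) measurable_snd.stronglyMeasurable).measurable
  refine ⟨f, hf, ?_⟩
  have hset : MeasurableSet {z : (Fin p → ℝ) × ℝ | z.2 = f z.1} :=
    measurableSet_eq_fun measurable_snd (hf.comp measurable_fst)
  have hXY : AEMeasurable (fun ω => (X ω, Y ω)) μ := (hX.prodMk hY).aemeasurable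
  have goal : ∀ᵐ z ∂(μ.map fun ω => (X ω, Y ω)), z.2 = f z.1 := by
    rw [← compProd_map_condDistrib hY.aemeasurable, Measure.ae_compProd_iff hset]
    have hm : MeasurableSet {x | ∀ᵐ t ∂(condDistrib Y X μ x), t = f x} := by
      have : {x | ∀ᵐ t ∂(condDistrib Y X μ x), t = f x} =
          (fun x => condDistrib Y X μ x (Prod.mk x ⁻¹' {z : (Fin p → ℝ) × ℝ | z.2 = f z.1}ᶜ)) ⁻¹'
            {0} := rfl
      rw [this]
      exact (Kernel.measurable_kernel_prodMk_left hset.compl) (measurableSet_singleton 0)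
    change ∀ᵐ x ∂(μ.map X), ∀ᵐ t ∂(condDistrib Y X μ x), t = f x
    rw [ae_map_iff hX.aemeasurable hm]
    filter_upwards [ae_all_iff.2 key] with ω hω
    obtain ⟨a, ha⟩ := aux_dirac _ hω
    have hfa : f (X ω) = a := by
      change ∫ t, t ∂(condDistrib Y X μ (X ω)) = a
      rw [integral_congr_ae (g := fun _ => a) ha]
      simp
    rw [hfa]
    exact ha
  exact ae_of_ae_map hXY goal
end

section
/- Let Z and Z' be real random variables with the same distribution. If Z and Z' are comonotone, i.e. ℙ(Z ≤ z, Z' ≤ z') = min{F_Z(z), F_{Z'}(z')} for all z, z' ∈ ℝ, then Z = Z' almost surely. -/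
open MeasureTheory ProbabilityTheory Set

/-- If `Z` and `Z'` have the same distribution and are comonotone, i.e.
`ℙ(Z ≤ z, Z' ≤ z') = min{F_Z(z), F_{Z'}(z')}` for all `z, z'`, then `Z = Z'` almost surely. -/
theorem eq_of_comonotone_of_identDistrib {Ω : Type*} [MeasurableSpace Ω]
    (μ : Measure Ω) [IsProbabilityMeasure μ] (Z Z' : Ω → ℝ)
    (hZ : Measurable Z) (hZ' : Measurable Z')
    (hdist : μ.map Z = μ.map Z')
    (hcomon : ∀ z z' : ℝ, μ {ω | Z ω ≤ z ∧ Z' ω ≤ z'}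
      = min (μ {ω | Z ω ≤ z}) (μ {ω | Z' ω ≤ z'})) :
    Z =ᵐ[μ] Z' := by
  have key : ∀ z : ℝ, μ {ω | Z ω ≤ z} = μ {ω | Z' ω ≤ z} := by
    intro z
    have h := congrArg (fun ν => ν (Iic z)) hdist
    simp only [Measure.map_apply hZ measurableSet_Iic,
      Measure.map_apply hZ' measurableSet_Iic] at h
    exact h
  have hm : ∀ z : ℝ, MeasurableSet {ω | Z ω ≤ z ∧ Z' ω ≤ z} := fun z =>
    (hZ measurableSet_Iic).inter (hZ' measurableSet_Iic)
  have hq : ∀ q : ℚ, ∀ᵐ ω ∂μ, (Z ω ≤ q ↔ Z' ω ≤ q) := by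
    intro q
    have e := hcomon q q
    have h1 : ({ω | Z ω ≤ q ∧ Z' ω ≤ q} : Set Ω) =ᵐ[μ] {ω | Z ω ≤ q} :=
      ae_eq_of_subset_of_measure_ge (fun ω h => h.1) (by rw [e, ← key, min_self])
        (hm q).nullMeasurableSet (measure_ne_top _ _)
    have h2 : ({ω | Z ω ≤ q ∧ Z' ω ≤ q} : Set Ω) =ᵐ[μ] {ω | Z' ω ≤ q} :=
      ae_eq_of_subset_of_measure_ge (fun ω h => h.2) (by rw [e, key, min_self])
        (hm q).nullMeasurableSet (measure_ne_top _ _)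
    filter_upwards [h1.symm.trans h2] with ω h
    exact iff_of_eq h
  filter_upwards [ae_all_iff.2 hq] with ω h
  apply le_antisymm
  · by_contra! hlt
    obtain ⟨q, a, b⟩ := exists_rat_btwn hlt
    exact absurd ((h q).2 a.le) (not_le.2 b)
  · by_contra! hlt
    obtain ⟨q, a, b⟩ := exists_rat_btwn hlt
    exact absurd ((h q).1 a.le) (not_le.2 b)
end

section
/- Let X be an ℝ^p-valued random vector and Y a real random variable. If for every y ∈ ℝ one has ℙ(Y ≤ y | X = x) ∈ {0,1} for ℙ^X-almost all x ∈ ℝ^p, then Y perfectly depends on X, i.e. there exists a measurable function f : ℝ^p → ℝ such that Y = f(X) almost surely; equivalently, for ℙ^X-almost every x there exists a constant c_x with ℙ(Y = c_x | X = x) = 1. -/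
open MeasureTheory ProbabilityTheory Set
open scoped ENNReal

lemma exists_atom_of_rat_zero_one (ν : Measure ℝ) [IsProbabilityMeasure ν]
    (h : ∀ q : ℚ, ν (Set.Iic (q : ℝ)) ∈ ({0, 1} : Set ℝ≥0∞)) : ∃ c : ℝ, ν {c} = 1 := by
  have h' : ∀ q : ℚ, ∀ᵐ y : ℝ ∂ν, (ν (Set.Iic (q : ℝ)) = 0 → ¬ y ≤ q) ∧
      (ν (Set.Iic (q : ℝ)) = 1 → y ≤ q) := by
    intro q
    rcases h q with h0 | h1
    · have : ∀ᵐ y ∂ν, ¬ y ≤ (q : ℝ) := by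
        rw [ae_iff]; simpa [Set.Iic] using h0
      filter_upwards [this] with y hy
      exact ⟨fun _ => hy, fun e => by rw [h0] at e; simp at e⟩
    · have h1 : ν (Set.Iic (q : ℝ)) = 1 := h1
      have : ∀ᵐ y ∂ν, y ∈ Set.Iic (q : ℝ) :=
        (prob_compl_eq_zero_iff measurableSet_Iic).2 h1
      filter_upwards [this] with y hy
      exact ⟨fun e => by rw [h1] at e; simp at e, fun _ => hy⟩
  have h2 := ae_all_iff.2 h'
  obtain ⟨c, hc⟩ := h2.exists
  refine ⟨c, (prob_compl_eq_zero_iff (measurableSet_singleton c)).1 ?_⟩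
  change ∀ᵐ y ∂ν, y ∈ ({c} : Set ℝ)
  filter_upwards [h2] with y hy
  by_contra hne
  rcases lt_or_gt_of_ne (show y ≠ c from hne) with hl | hl
  · obtain ⟨q, hq1, hq2⟩ := exists_rat_btwn hl
    rcases h q with h0 | h1
    · exact (hy q).1 h0 hq1.le
    · exact absurd ((hc q).2 h1) (not_le.2 hq2)
  · obtain ⟨q, hq1, hq2⟩ := exists_rat_btwn hl
    rcases h q with h0 | h1
    · exact (hc q).1 h0 hq1.le
    · exact absurd ((hy q).2 h1) (not_le.2 hq2)

/-- If for every `y ∈ ℝ` the conditional probability `ℙ(Y ≤ y ∣ X = x)` is `0` or `1` for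
`ℙ^X`-almost all `x`, then `Y` perfectly depends on `X`: there is a measurable
`f : ℝ^p → ℝ` with `Y = f(X)` almost surely; equivalently, for `ℙ^X`-almost every `x` there
is a constant `c` with `ℙ(Y = c ∣ X = x) = 1`. -/
theorem perfect_dependence_of_condCdf_zero_one {Ω : Type*} [MeasurableSpace Ω]
    [StandardBorelSpace Ω] [Nonempty Ω] {p : ℕ} (μ : Measure Ω) [IsProbabilityMeasure μ]
    (X : Ω → (Fin p → ℝ)) (Y : Ω → ℝ)
    (hX : Measurable X) (hY : Measurable Y)
    (h01 : ∀ y : ℝ, ∀ᵐ x ∂(μ.map X),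
      condDistrib Y X μ x (Set.Iic y) ∈ ({0, 1} : Set ℝ≥0∞)) :
    (∃ f : (Fin p → ℝ) → ℝ, Measurable f ∧ Y =ᵐ[μ] fun ω => f (X ω)) ∧
    (∀ᵐ x ∂(μ.map X), ∃ c : ℝ, condDistrib Y X μ x {c} = 1) := by
  have hc : ∀ᵐ x ∂(μ.map X), ∃ c : ℝ, condDistrib Y X μ x {c} = 1 := by
    filter_upwards [ae_all_iff.2 fun q : ℚ => h01 q] with x hx
    exact exists_atom_of_rat_zero_one _ hx
  refine ⟨⟨fun x => ∫ y, y ∂(condDistrib Y X μ x), ?_, ?_⟩, hc⟩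
  · exact (StronglyMeasurable.integral_kernel (κ := condDistrib Y X μ)
      (f := fun y : ℝ => y) stronglyMeasurable_id).measurable
  · have hf : Measurable fun x => ∫ y, y ∂(condDistrib Y X μ x) :=
      (StronglyMeasurable.integral_kernel (κ := condDistrib Y X μ)
        (f := fun y : ℝ => y) stronglyMeasurable_id).measurable
    have key : ∀ᵐ z ∂(μ.map X ⊗ₘ condDistrib Y X μ),
        z.2 = ∫ y, y ∂(condDistrib Y X μ z.1) := by
      refine (Measure.ae_compProd_iff
        (measurableSet_eq_fun measurable_snd (hf.comp measurable_fst))).2 ?_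
      filter_upwards [hc] with x ⟨c, hx⟩
      have h1 : ∀ᵐ y ∂(condDistrib Y X μ x), y = c :=
        (prob_compl_eq_zero_iff (measurableSet_singleton c)).2 hx
      have h2 : ∫ y, y ∂(condDistrib Y X μ x) = c := by
        rw [integral_congr_ae h1]; simp
      filter_upwards [h1] with y hy
      exact hy.trans h2.symm
    rw [compProd_map_condDistrib hY.aemeasurable] at key
    exact ae_of_ae_map (hX.prodMk hY).aemeasurable key
end

section
/- Let (Y,Y') be the Markov product of (X,Y). Then for every y ∈ ℝ, ℙ(Y ≤ y, Y' ≤ y) = 𝔼[ℙ(Y ≤ y | X)²] ≥ ℙ(Y ≤ y)²; i.e. the Markov product is positively dependent along the diagonal. -/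
open MeasureTheory ProbabilityTheory Set

/-- Positive dependence of the Markov product along the diagonal: for every `y ∈ ℝ`,
`ℙ(Y ≤ y, Y' ≤ y) = 𝔼[ℙ(Y ≤ y ∣ X)²] ≥ ℙ(Y ≤ y)²`. -/
theorem markov_product_diagonal {Ω : Type*} [MeasurableSpace Ω] [StandardBorelSpace Ω]
    [Nonempty Ω] {p : ℕ} (μ : Measure Ω) [IsProbabilityMeasure μ]
    (X : Ω → (Fin p → ℝ)) (Y Y' : Ω → ℝ)
    (hX : Measurable X) (hY : Measurable Y) (hY' : Measurable Y')
    (hcopy : IsCondIndepCopy μ X hX Y Y') :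
    ∀ y : ℝ,
      (μ {ω | Y ω ≤ y ∧ Y' ω ≤ y}).toReal
          = ∫ ω, (condDistrib Y X μ (X ω) (Set.Iic y)).toReal ^ 2 ∂μ ∧
      (μ {ω | Y ω ≤ y}).toReal ^ 2 ≤ (μ {ω | Y ω ≤ y ∧ Y' ω ≤ y}).toReal := by
  intro y
  obtain ⟨hc, hi⟩ := hcopy
  have hA : MeasurableSet (Y ⁻¹' Set.Iic y) := hY measurableSet_Iic
  have hA' : MeasurableSet (Y' ⁻¹' Set.Iic y) := hY' measurableSet_Iic
  have hset : {ω | Y ω ≤ y ∧ Y' ω ≤ y} = Y ⁻¹' Set.Iic y ∩ Y' ⁻¹' Set.Iic y := rfl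
  have hset1 : {ω | Y ω ≤ y} = Y ⁻¹' Set.Iic y := rfl
  have h1 := condDistrib_ae_eq_condExp (μ := μ) hX hY (measurableSet_Iic (a := y))
  have h2 := condDistrib_ae_eq_condExp (μ := μ) hX hY' (measurableSet_Iic (a := y))
  have h3 := (condIndepFun_iff_condExp_inter_preimage_eq_mul hY hY').1 hi _ _
    (measurableSet_Iic (a := y)) (measurableSet_Iic (a := y))
  have hc' := ae_of_ae_map hX.aemeasurable hc
  have key : ∀ s : Set Ω, MeasurableSet s →
      (μ s).toReal = ∫ ω, (μ⟦s | MeasurableSpace.comap X inferInstance⟧) ω ∂μ := by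
    intro s hs
    rw [integral_condExp hX.comap_le, integral_indicator hs]
    simp [Measure.real]
  have e1 : (μ {ω | Y ω ≤ y ∧ Y' ω ≤ y}).toReal
      = ∫ ω, (condDistrib Y X μ (X ω) (Set.Iic y)).toReal ^ 2 ∂μ := by
    rw [hset, key _ (hA.inter hA')]
    apply integral_congr_ae
    filter_upwards [h1, h2, h3, hc'] with ω a1 a2 a3 a4
    rw [a3, ← a1, ← a2]
    simp only [Measure.real]
    rw [a4, sq]
  refine ⟨e1, ?_⟩
  have e2 : (μ {ω | Y ω ≤ y}).toReal
      = ∫ ω, (condDistrib Y X μ (X ω) (Set.Iic y)).toReal ∂μ := by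
    rw [hset1, key _ hA]
    exact (integral_congr_ae h1).symm
  rw [e1, e2]
  have hm : Measurable fun ω => (condDistrib Y X μ (X ω) (Set.Iic y)).toReal :=
    ((Kernel.measurable_coe _ measurableSet_Iic).comp hX).ennreal_toReal
  have hL : MemLp (fun ω => (condDistrib Y X μ (X ω) (Set.Iic y)).toReal) 2 μ := by
    refine MemLp.of_bound hm.aestronglyMeasurable 1 (ae_of_all _ fun ω => ?_)
    rw [Real.norm_of_nonneg ENNReal.toReal_nonneg]
    exact measureReal_le_one
  have hv := variance_nonneg (fun ω => (condDistrib Y X μ (X ω) (Set.Iic y)).toReal) μ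
  rw [variance_eq_sub hL] at hv
  simpa using hv
end

section
/- Let μ and ν be probability measures on ℝ with relative effect Ψ(μ,ν) ∈ {0,1}. Then the open intervals (inf supp μ, sup supp μ) and (inf supp ν, sup supp ν) are disjoint. -/
open MeasureTheory ProbabilityTheory Set

/-- The (topological) support of a measure on `ℝ`: the set of points all of whose open
neighbourhoods have positive measure. -/
def msupport (μ : Measure ℝ) : Set ℝ :=
  {x | ∀ U : Set ℝ, IsOpen U → x ∈ U → 0 < μ U}

/-- The open interval `(inf supp μ, sup supp μ)`, with infimum and supremum taken in the
extended reals to account for unbounded supports. -/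
noncomputable def suppInterval (μ : Measure ℝ) : Set ℝ :=
  {x : ℝ | sInf ((fun y : ℝ => (y : EReal)) '' msupport μ) < (x : EReal) ∧
    (x : EReal) < sSup ((fun y : ℝ => (y : EReal)) '' msupport μ)}

lemma sI_pos (μ : Measure ℝ) {x : ℝ} (hx : x ∈ suppInterval μ) :
    0 < μ.real (Iio x) ∧ 0 < μ.real (Ioi x) ∨ ¬ IsProbabilityMeasure μ := by
  by_cases hp : IsProbabilityMeasure μ
  swap
  · exact Or.inr hp
  left
  obtain ⟨h1, h2⟩ := hx
  obtain ⟨_, ⟨a, ha, rfl⟩, hax⟩ := sInf_lt_iff.1 h1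
  obtain ⟨_, ⟨b, hb, rfl⟩, hbx⟩ := lt_sSup_iff.1 h2
  have hax' : a < x := EReal.coe_lt_coe_iff.1 hax
  have hbx' : x < b := EReal.coe_lt_coe_iff.1 hbx
  exact ⟨ENNReal.toReal_pos (ha _ isOpen_Iio hax').ne' (measure_ne_top _ _),
    ENNReal.toReal_pos (hb _ isOpen_Ioi hbx').ne' (measure_ne_top _ _)⟩

/-- If the relative effect of two probability measures `μ, ν` on `ℝ` satisfies
`Ψ(μ, ν) ∈ {0, 1}`, then the open intervals `(inf supp μ, sup supp μ)` and
`(inf supp ν, sup supp ν)` are disjoint. -/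
theorem suppInterval_disjoint_of_relEffect_extreme
    (μ ν : Measure ℝ) [IsProbabilityMeasure μ] [IsProbabilityMeasure ν]
    (h : relEffect μ ν ∈ ({0, 1} : Set ℝ)) :
    Disjoint (suppInterval μ) (suppInterval ν) := by
  rw [Set.disjoint_left]
  intro x hxμ hxν
  obtain ⟨hμ1, hμ2⟩ := (sI_pos μ hxμ).resolve_right (not_not.2 inferInstance)
  obtain ⟨hν1, hν2⟩ := (sI_pos ν hxν).resolve_right (not_not.2 inferInstance)
  set f : ℝ → ℝ := fun z => (μ (Set.Iio z)).toReal + (1 / 2) * (μ {z}).toReal with hf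
  have hsum : ∀ z, μ.real (Iio z) + μ.real {z} = μ.real (Iic z) := by
    intro z
    rw [← measureReal_union (by simp) (measurableSet_singleton z), Iio_union_right]
  have hfe : ∀ z, f z = (μ.real (Iio z) + μ.real (Iic z)) / 2 := by
    intro z
    have := hsum z
    simp only [hf, measureReal_def] at *
    linarith
  have hmono : Monotone f := by
    intro a b hab
    rw [hfe, hfe]
    have h1 : μ.real (Iio a) ≤ μ.real (Iio b) := measureReal_mono (Iio_subset_Iio hab)
    have h2 : μ.real (Iic a) ≤ μ.real (Iic b) := measureReal_mono (Iic_subset_Iic.2 hab)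
    linarith
  have h0 : ∀ z, 0 ≤ f z := fun z => by simp only [hf]; positivity
  have h1 : ∀ z, f z ≤ 1 := by
    intro z
    rw [hfe]
    have h1 : μ.real (Iio z) ≤ 1 := measureReal_le_one
    have h2 : μ.real (Iic z) ≤ 1 := measureReal_le_one
    linarith
  have hint : Integrable f ν := by
    refine Integrable.of_bound hmono.measurable.aestronglyMeasurable 1 (ae_of_all _ fun z => ?_)
    rw [Real.norm_of_nonneg (h0 z)]
    exact h1 z
  have hfx0 : 0 < f x := by
    rw [hfe]
    have : 0 ≤ μ.real (Iic x) := measureReal_nonneg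
    linarith
  have hfx1 : f x < 1 := by
    rw [hfe]
    have h3 : μ.real (Iio x) ≤ 1 := measureReal_le_one
    have h4 : μ.real (Iic x) + μ.real (Ioi x) = 1 := by
      have := probReal_add_probReal_compl (μ := μ) (measurableSet_Iic (a := x))
      rwa [compl_Iic] at this
    linarith
  rcases h with h | h
  · have h' : ∫ z, f z ∂ν = 0 := h
    rw [integral_eq_zero_iff_of_nonneg h0 hint] at h'
    have hz : ν (Ioi x) = 0 := by
      refine measure_mono_null ?_ (ae_iff.1 h')
      intro z hz hfz
      have h5 : f z = 0 := hfz
      have := hmono (le_of_lt (mem_Ioi.1 hz))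
      linarith
    simp [measureReal_def, hz] at hν2
  · have h' : ∫ z, f z ∂ν = 1 := h
    have h6 : ∫ z, (1 - f z) ∂ν = 0 := by
      rw [integral_sub (integrable_const _) hint, h']
      simp
    rw [integral_eq_zero_iff_of_nonneg (fun z => sub_nonneg.2 (h1 z))
      ((integrable_const _).sub hint)] at h6
    have hz : ν (Iio x) = 0 := by
      refine measure_mono_null ?_ (ae_iff.1 h6)
      intro z hz hfz
      have h5 : 1 - f z = 0 := hfz
      have := hmono (le_of_lt (mem_Iio.1 hz))
      linarith
    simp [measureReal_def, hz] at hν1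
end

section
/- Let (F_Y(Y), F_Y(Y')) be the Markov product of (X, F_Y(Y)) and set M = {z ∈ ℝ^p : ℙ(X = z) > 0}. If Y is completely separated relative to X, then the joint distribution function of (F_Y(Y), F_Y(Y')) admits an ordinal sum structure (⟨(a_z,b_z], F_z⟩)_{z∈M} of size |M| such that for every z ∈ M one has b_z − a_z = ℙ(X = z) and F_z(u,v) = F_z(u,b_z)·F_z(b_z,v) for all (u,v) ∈ (a_z,b_z]². -/
open MeasureTheory ProbabilityTheory Set

/-- `Y` is completely separated relative to `X` if
`Ψ(ℙ^{Y|X=x₁}, ℙ^{Y|X=x₂}) ∈ {0, 1}` for `(ℙ^X ⊗ ℙ^X)`-almost all `(x₁, x₂)`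
with `x₁ ≠ x₂`. -/
def CompletelySeparated {Ω E : Type*} [MeasurableSpace Ω] [MeasurableSpace E]
    (μ : Measure Ω) [IsFiniteMeasure μ] (X : Ω → E) (Y : Ω → ℝ) : Prop :=
  ∀ᵐ q ∂((μ.map X).prod (μ.map X)), q.1 ≠ q.2 →
    relEffect (condDistrib Y X μ q.1) (condDistrib Y X μ q.2) ∈ ({0, 1} : Set ℝ)

/-- The distribution function `F_Y(y) = ℙ(Y ≤ y)` of a real random variable `Y`. -/
noncomputable def distFun {Ω : Type*} [MeasurableSpace Ω] (μ : Measure Ω) (Y : Ω → ℝ) :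
    ℝ → ℝ :=
  fun y => (μ {ω | Y ω ≤ y}).toReal

/-- `G : [0,1]² → ℝ` (a joint distribution function on `[0,1]²`) admits an ordinal sum
structure `(⟨(a_z, b_z], F_z⟩)_{z ∈ M}` indexed by `M = {z : ℙ(X = z) > 0}` such that for
every `z ∈ M` one has `b_z − a_z = ℙ(X = z)` and
`F_z(u,v) = F_z(u,b_z) · F_z(b_z,v)` on `(a_z, b_z]²`.  Each two-dimensional distribution
function `F_z` is encoded by a probability measure `ν z` on `ℝ²` with support in
`(a_z, b_z]²`, `F_z(u,v) = ν z ((−∞,u] × (−∞,v])`. -/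
def HasSeparatedOrdinalSum {Ω : Type*} [MeasurableSpace Ω] {p : ℕ}
    (μ : Measure Ω) (X : Ω → (Fin p → ℝ)) (G : ℝ → ℝ → ℝ) : Prop :=
  ∃ (a b : {z : Fin p → ℝ // 0 < μ.map X {z}} → ℝ)
    (ν : {z : Fin p → ℝ // 0 < μ.map X {z}} → Measure (ℝ × ℝ)),
    (∀ z, 0 ≤ a z ∧ a z < b z ∧ b z ≤ 1) ∧
    (Pairwise fun z w => Disjoint (Set.Ioc (a z) (b z)) (Set.Ioc (a w) (b w))) ∧
    (∀ z, IsProbabilityMeasure (ν z)) ∧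
    (∀ z, ν z (Set.Ioc (a z) (b z) ×ˢ Set.Ioc (a z) (b z)) = 1) ∧
    (∀ z, b z - a z = (μ.map X {z.1}).toReal) ∧
    (∀ z, ∀ u ∈ Set.Ioc (a z) (b z), ∀ v ∈ Set.Ioc (a z) (b z),
      (ν z (Set.Iic u ×ˢ Set.Iic v)).toReal
        = (ν z (Set.Iic u ×ˢ Set.Iic (b z))).toReal
            * (ν z (Set.Iic (b z) ×ˢ Set.Iic v)).toReal) ∧
    (∀ u ∈ Set.Icc (0 : ℝ) 1, ∀ v ∈ Set.Icc (0 : ℝ) 1,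
      G u v = (∑' z, (b z - a z) * (ν z (Set.Iic u ×ˢ Set.Iic v)).toReal)
        + (volume (Set.Icc 0 (min u v) \ ⋃ z, Set.Ioc (a z) (b z))).toReal)

namespace OrdSum

set_option linter.unusedSectionVars false

lemma meas_le_of_Iic (m : Measure ℝ) [IsFiniteMeasure m] {S : Set ℝ} (hS : MeasurableSet S)
    {t : ENNReal} (h : ∀ s ∈ S, m (Iic s) ≤ t) : m S ≤ t := by
  by_contra hlt
  push Not at hlt
  obtain ⟨K, hKS, hK, hKt⟩ := hS.exists_lt_isCompact hlt
  have hne : K.Nonempty := by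
    rw [nonempty_iff_ne_empty]; rintro rfl; simp at hKt
  obtain ⟨k, hk, hmax⟩ := hK.exists_isGreatest hne
  exact absurd ((measure_mono (fun x hx => hmax hx)).trans (h k (hKS hk))) (not_le.mpr hKt)

lemma meas_le_of_Ici (m : Measure ℝ) [IsFiniteMeasure m] {S : Set ℝ} (hS : MeasurableSet S)
    {t : ENNReal} (h : ∀ s ∈ S, m (Ici s) ≤ t) : m S ≤ t := by
  by_contra hlt
  push Not at hlt
  obtain ⟨K, hKS, hK, hKt⟩ := hS.exists_lt_isCompact hlt
  have hne : K.Nonempty := by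
    rw [nonempty_iff_ne_empty]; rintro rfl; simp at hKt
  obtain ⟨k, hk, hmax⟩ := hK.exists_isLeast hne
  exact absurd ((measure_mono (fun x hx => hmax hx)).trans (h k (hKS hk))) (not_le.mpr hKt)

lemma meas_Iic (m : Measure ℝ) : Measurable fun y => m (Iic y) :=
  Monotone.measurable fun _ _ h => measure_mono (Iic_subset_Iic.mpr h)

lemma meas_Iio (m : Measure ℝ) : Measurable fun y => m (Iio y) :=
  Monotone.measurable fun _ _ h => measure_mono (Iio_subset_Iio h)

/-- strict separation -/
def Below (P Q : Measure ℝ) : Prop := ∀ᵐ y ∂Q, ∀ᵐ y' ∂P, y' < y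

lemma ae_lt_iff (P : Measure ℝ) [IsProbabilityMeasure P] (y : ℝ) :
    (∀ᵐ y' ∂P, y' < y) ↔ P (Iio y) = 1 := by
  rw [← prob_compl_eq_zero_iff measurableSet_Iio]; rfl

lemma ae_gt_iff (P : Measure ℝ) (y : ℝ) :
    (∀ᵐ y' ∂P, y < y') ↔ P (Iic y) = 0 := by
  rw [ae_iff]; simp [Iic]

lemma below_iff_comm (P Q : Measure ℝ) [IsProbabilityMeasure P] [IsProbabilityMeasure Q] :
    Below P Q ↔ ∀ᵐ y' ∂P, ∀ᵐ y ∂Q, y' < y := by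
  unfold Below
  exact Measure.ae_ae_comm (p := fun y y' => y' < y) (measurableSet_lt measurable_snd measurable_fst)

lemma below_or (P Q : Measure ℝ) [IsProbabilityMeasure P] [IsProbabilityMeasure Q]
    (h : relEffect P Q ∈ ({0, 1} : Set ℝ)) : Below P Q ∨ Below Q P := by
  have key : ∀ z, (P (Iio z)).toReal + (P {z}).toReal = (P (Iic z)).toReal := by
    intro z
    rw [← ENNReal.toReal_add (by simp) (by simp), ← measure_union (by simp) (by simp)]
    congr 2; ext x; simp [le_iff_lt_or_eq, or_comm]
  have hle : ∀ z, (P (Iic z)).toReal ≤ 1 := fun z => ENNReal.toReal_le_of_le_ofReal (by simp) (by simpa using prob_le_one)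
  have h0 : ∀ z, 0 ≤ (P (Iio z)).toReal := fun z => ENNReal.toReal_nonneg
  have h0' : ∀ z, 0 ≤ (P {z}).toReal := fun z => ENNReal.toReal_nonneg
  set f : ℝ → ℝ := fun z => (P (Iio z)).toReal + (1 / 2) * (P {z}).toReal with hf
  have hfm : Measurable f := by
    have : f = fun z => (1/2) * ((P (Iio z)).toReal + (P (Iic z)).toReal) := by
      ext z; rw [← key z]; simp only [hf]; ring
    rw [this]
    exact (((meas_Iio P).ennreal_toReal).add ((meas_Iic P).ennreal_toReal)).const_mul _
  have hf0 : ∀ z, 0 ≤ f z := fun z => by have := h0 z; have := h0' z; simp only [hf]; linarith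
  have hf1 : ∀ z, f z ≤ 1 := fun z => by
    have := h0 z; have := h0' z; have := key z; have := hle z; simp only [hf]; linarith
  have hint : Integrable f Q := by
    refine Integrable.of_bound hfm.aestronglyMeasurable 1 (.of_forall fun z => ?_)
    rw [Real.norm_eq_abs, abs_of_nonneg (hf0 z)]; exact hf1 z
  have hrel : relEffect P Q = ∫ z, f z ∂Q := rfl
  rw [hrel] at h
  rcases h with h | h
  · right
    rw [integral_eq_zero_iff_of_nonneg hf0 hint] at h
    rw [below_iff_comm]
    filter_upwards [h] with y hy
    rw [ae_gt_iff]
    have h1 := key y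
    have h2 : f y = 0 := hy
    simp only [hf] at h2
    have : (P (Iic y)).toReal = 0 := by have := h0 y; have := h0' y; linarith
    rwa [ENNReal.toReal_eq_zero_iff, or_iff_left (by simp)] at this
  · left
    have h' : ∫ z, (1 - f z) ∂Q = 0 := by
      rw [integral_sub (by simp) hint, mem_singleton_iff.mp h]; simp
    rw [integral_eq_zero_iff_of_nonneg (fun z => sub_nonneg.mpr (hf1 z)) ((integrable_const 1).sub hint)] at h'
    filter_upwards [h'] with y hy
    rw [ae_lt_iff]
    have h1 := key y
    have h2 : 1 - f y = 0 := hy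
    simp only [hf] at h2
    have : (P (Iio y)).toReal = 1 := by have := h0 y; have := h0' y; have := hle y; linarith
    rwa [ENNReal.toReal_eq_one_iff] at this

lemma below_irrefl (P : Measure ℝ) [IsProbabilityMeasure P] : ¬ Below P P := by
  intro h
  have h1 : ∀ᵐ y ∂P, P (Ici y) = 0 := by
    filter_upwards [h] with y hy
    rw [ae_iff] at hy; simpa [Ici] using hy
  have hm : Measurable fun y => P (Ici y) :=
    Antitone.measurable fun _ _ h => measure_mono (Ici_subset_Ici.mpr h)
  have h2 := meas_le_of_Ici P (S := {y | P (Ici y) = 0}) (hm (measurableSet_singleton 0))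
    (t := 0) (fun s hs => le_of_eq hs)
  have h3 := prob_compl_eq_zero_iff (μ := P) (s := {y | P (Ici y) = 0}) (hm (measurableSet_singleton 0))
  rw [h3.mp h1] at h2
  simp at h2

lemma below_trans {P Q R : Measure ℝ} [IsProbabilityMeasure Q]
    (h1 : Below P Q) (h2 : Below Q R) : Below P R := by
  filter_upwards [h2] with y hy
  obtain ⟨y0, h3, h4⟩ := (h1.and hy).exists
  filter_upwards [h3] with y' hy'
  exact hy'.trans h4

lemma Iic_pos (P : Measure ℝ) [IsProbabilityMeasure P] : ∀ᵐ y ∂P, 0 < P (Iic y) := by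
  have := meas_le_of_Iic P (S := {y | P (Iic y) = 0}) (meas_Iic P (measurableSet_singleton 0))
    (t := 0) (fun s hs => le_of_eq hs)
  rw [ae_iff]
  simpa using this

section K
variable {E : Type*} [MeasurableSpace E] [MeasurableSingletonClass E] (η : Measure E) [IsProbabilityMeasure η]
  (κ : Kernel E ℝ) [IsMarkovKernel κ]

lemma meas_kIio : Measurable fun q : E × ℝ => κ q.1 (Iio q.2) :=
  Kernel.measurable_kernel_prodMk_left (κ := κ.prodMkRight ℝ) (t := {r : (E × ℝ) × ℝ | r.2 < r.1.2})
    (measurableSet_lt measurable_snd measurable_fst.snd)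

lemma meas_kIic : Measurable fun q : E × ℝ => κ q.1 (Iic q.2) :=
  Kernel.measurable_kernel_prodMk_left (κ := κ.prodMkRight ℝ) (t := {r : (E × ℝ) × ℝ | r.2 ≤ r.1.2})
    (measurableSet_le measurable_snd measurable_fst.snd)

lemma meas_below (x : E) : MeasurableSet {x' | Below (κ x') (κ x)} := by
  have h : MeasurableSet {q : E × ℝ | κ q.1 (Iio q.2) ≠ 1} :=
    (meas_kIio κ (measurableSet_singleton 1)).compl
  have h2 := measurable_measure_prodMk_left (ν := κ x) h (measurableSet_singleton 0)
  convert h2 using 1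
  ext x'
  have e : Below (κ x') (κ x) ↔ ∀ᵐ y ∂κ x, κ x' (Iio y) = 1 := by
    unfold Below
    exact Filter.eventually_congr (.of_forall fun y => ae_lt_iff _ _)
  exact e.trans ae_iff

/-- mass below -/
noncomputable def c (x : E) : ENNReal := η {x' | Below (κ x') (κ x)}

lemma c_step {x z : E} (h : Below (κ z) (κ x)) : c η κ z + η {z} ≤ c η κ x := by
  unfold c
  rw [← measure_union]
  · refine measure_mono (union_subset (fun x' hx' => ?_) ?_)
    · exact below_trans hx' h
    · simpa using h
  · simpa using below_irrefl (κ z)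
  · simp

lemma formula (m : Measure ℝ) (hm : ∀ s, MeasurableSet s → m s = ∫⁻ x, κ x s ∂η) (x : E)
    (hx : ∀ᵐ x' ∂η, x' ≠ x → Below (κ x') (κ x) ∨ Below (κ x) (κ x')) :
    ∀ᵐ y ∂κ x, m (Iio y) = c η κ x + η {x} * κ x (Iio y) ∧
      m (Iic y) = c η κ x + η {x} * κ x (Iic y) := by
  set S := {x' | Below (κ x') (κ x)} with hSdef
  have hS : MeasurableSet S := meas_below κ x
  have hxS : x ∉ S := below_irrefl (κ x)
  have h1 : ∀ᵐ x' ∂η, ∀ᵐ y ∂κ x, x' ≠ x →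
      (x' ∈ S ∧ κ x' (Iio y) = 1) ∨ (x' ∉ S ∧ κ x' (Iic y) = 0) := by
    filter_upwards [hx] with x' hx'
    by_cases hne : x' = x
    · simp [hne]
    by_cases hxx : x' ∈ S
    · have : Below (κ x') (κ x) := hxx
      filter_upwards [this] with y hy _
      exact Or.inl ⟨hxx, (ae_lt_iff _ _).mp hy⟩
    · have := (hx' hne).resolve_left hxx
      rw [below_iff_comm] at this
      filter_upwards [this] with y hy _
      exact Or.inr ⟨hxx, (ae_gt_iff _ _).mp hy⟩
  rw [Measure.ae_ae_comm] at h1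
  swap
  · have e1 : MeasurableSet {q : E × ℝ | q.1 = x} := measurable_fst (measurableSet_singleton x)
    have e2 : MeasurableSet {q : E × ℝ | q.1 ∈ S} := measurable_fst hS
    have e3 : MeasurableSet {q : E × ℝ | κ q.1 (Iio q.2) = 1} := meas_kIio κ (measurableSet_singleton 1)
    have e4 : MeasurableSet {q : E × ℝ | κ q.1 (Iic q.2) = 0} := meas_kIic κ (measurableSet_singleton 0)
    convert e1.union ((e2.inter e3).union (e2.compl.inter e4)) using 1
    ext q
    simp only [mem_ofPred_eq, mem_union, mem_inter_iff, mem_compl_iff]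
    tauto
  have gen : ∀ T : Set ℝ, MeasurableSet T → (∀ᵐ x' ∂η, x' ≠ x →
      (x' ∈ S ∧ κ x' T = 1) ∨ (x' ∉ S ∧ κ x' T = 0)) → m T = c η κ x + η {x} * κ x T := by
    intro T hT h
    rw [hm T hT]
    have : ∀ᵐ x' ∂η, κ x' T = S.indicator (fun _ => 1) x' + ({x} : Set E).indicator (fun _ => κ x T) x' := by
      filter_upwards [h] with x' hx'
      by_cases hne : x' = x
      · subst hne; simp [hxS]
      · rcases hx' hne with ⟨a, b⟩ | ⟨a, b⟩ <;> simp [a, b, hne]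
    rw [lintegral_congr_ae this, lintegral_add_left (measurable_const.indicator hS),
      lintegral_indicator hS, lintegral_indicator (measurableSet_singleton x)]
    simp [c, hSdef, mul_comm]
  filter_upwards [h1] with y hy
  refine ⟨gen _ measurableSet_Iio ?_, gen _ measurableSet_Iic ?_⟩
  · filter_upwards [hy] with x' hx' hne
    rcases hx' hne with h | ⟨h, h'⟩
    · exact Or.inl h
    · exact Or.inr ⟨h, le_antisymm (h' ▸ measure_mono Iio_subset_Iic_self) bot_le⟩
  · filter_upwards [hy] with x' hx' hne
    rcases hx' hne with ⟨h, h'⟩ | h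
    · exact Or.inl ⟨h, le_antisymm prob_le_one (h' ▸ measure_mono Iio_subset_Iic_self)⟩
    · exact Or.inr h
end K

lemma vol_adm {ι : Type*} [Countable ι] (a b : ι → ℝ) (h0 : ∀ z, 0 ≤ a z ∧ a z < b z)
    (hd : Pairwise fun z w => Disjoint (Ioc (a z) (b z)) (Ioc (a w) (b w)))
    (w : ℝ) (hw : ∀ z, b z ≤ w ∨ w ≤ a z) :
    volume (Icc 0 w \ ⋃ z, Ioc (a z) (b z)) + ∑' z, (if b z ≤ w then ENNReal.ofReal (b z - a z) else 0)
      = ENNReal.ofReal w := by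
  have hU : MeasurableSet (⋃ z, Ioc (a z) (b z)) := .iUnion fun _ => measurableSet_Ioc
  have h1 := measure_sdiff_add_inter (μ := volume) (Icc (0:ℝ) w) hU
  rw [Real.volume_Icc, sub_zero] at h1
  rw [← h1]
  congr 1
  rw [inter_iUnion, measure_iUnion]
  · refine tsum_congr fun z => ?_
    obtain ⟨ha, hab⟩ := h0 z
    split_ifs with h
    · rw [inter_eq_right.mpr, Real.volume_Ioc]
      intro x hx
      exact ⟨ha.trans hx.1.le, hx.2.trans h⟩
    · have h2 := (hw z).resolve_left h
      have : Icc 0 w ∩ Ioc (a z) (b z) = ∅ := by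
        ext x
        simp only [mem_inter_iff, mem_Icc, mem_Ioc, mem_empty_iff_false, iff_false]
        rintro ⟨⟨_, h3⟩, h4, _⟩
        linarith
      simp [this]
  · intro z w' hne
    exact (hd hne).mono inter_subset_right inter_subset_right
  · intro z; exact measurableSet_Icc.inter measurableSet_Ioc

section K2
variable {E : Type*} [MeasurableSpace E] [MeasurableSingletonClass E] (η : Measure E) [IsProbabilityMeasure η]
  (κ : Kernel E ℝ) [IsMarkovKernel κ]

lemma countable_M : {z : E | 0 < η {z}}.Countable :=
  Measure.countable_meas_pos_of_disjoint_iUnion (As := fun z : E => ({z} : Set E))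
    (fun _ => measurableSet_singleton _) (fun _ _ h => by simpa [Function.onFun] using h)

lemma c_add_le_one (z : E) : c η κ z + η {z} ≤ 1 := by
  unfold c
  rw [← measure_union]
  · exact prob_le_one
  · simpa using below_irrefl (κ z)
  · simp

lemma c_ne_top (z : E) : c η κ z ≠ ⊤ := measure_ne_top _ _

/-- left endpoint -/
noncomputable def A (z : E) : ℝ := (c η κ z).toReal
/-- right endpoint -/
noncomputable def B (z : E) : ℝ := (c η κ z + η {z}).toReal

lemma ofA (z : E) : ENNReal.ofReal (A η κ z) = c η κ z := ENNReal.ofReal_toReal (c_ne_top η κ z)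
lemma B_ne (z : E) : c η κ z + η {z} ≠ ⊤ := ne_top_of_le_ne_top (by simp) (c_add_le_one η κ z)
lemma ofB (z : E) : ENNReal.ofReal (B η κ z) = c η κ z + η {z} := ENNReal.ofReal_toReal (B_ne η κ z)
lemma B_eq (z : E) : B η κ z = A η κ z + (η {z}).toReal := by
  unfold A B; rw [ENNReal.toReal_add (c_ne_top η κ z) (by simp)]
lemma A_nonneg (z : E) : 0 ≤ A η κ z := ENNReal.toReal_nonneg
lemma B_le (z : E) : B η κ z ≤ 1 := ENNReal.toReal_le_of_le_ofReal (by simp) (by simpa using c_add_le_one η κ z)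
lemma A_lt_B (z : E) (hz : 0 < η {z}) : A η κ z < B η κ z := by
  rw [B_eq]; have := ENNReal.toReal_pos hz.ne' (by simp); linarith

lemma lint_split (f : E → ENNReal) :
    ∫⁻ x, f x ∂η = (∑' z : {z : E // 0 < η {z}}, η {z.1} * f z) + ∫⁻ x in {z : E | 0 < η {z}}ᶜ, f x ∂η := by
  rw [← lintegral_add_compl f (countable_M η).measurableSet, lintegral_countable _ (countable_M η)]
  congr 1
  exact tsum_congr fun z => mul_comm _ _

variable (m : Measure ℝ) [IsProbabilityMeasure m] (hm : ∀ s, MeasurableSet s → m s = ∫⁻ x, κ x s ∂η)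
  (hg : ∀ᵐ x ∂η, ∀ᵐ x' ∂η, x' ≠ x → Below (κ x') (κ x) ∨ Below (κ x) (κ x'))

include hg in
lemma good_atom {z : E} (hz : 0 < η {z}) :
    ∀ᵐ x' ∂η, x' ≠ z → Below (κ x') (κ z) ∨ Below (κ z) (κ x') := by
  by_contra h
  have : η {z} ≤ η {x | ¬ ∀ᵐ x' ∂η, x' ≠ x → Below (κ x') (κ x) ∨ Below (κ x) (κ x')} :=
    measure_mono (by simpa using h)
  rw [ae_iff.mp hg] at this
  exact absurd hz (not_lt.mpr this)

lemma good_pair {x z : E} (hz : 0 < η {z})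
    (hx : ∀ᵐ x' ∂η, x' ≠ x → Below (κ x') (κ x) ∨ Below (κ x) (κ x')) (hne : z ≠ x) :
    B η κ z ≤ A η κ x ∨ B η κ x ≤ A η κ z := by
  have : Below (κ z) (κ x) ∨ Below (κ x) (κ z) := by
    by_contra h
    have h1 : η {z} ≤ η {x' | ¬ (x' ≠ x → Below (κ x') (κ x) ∨ Below (κ x) (κ x'))} :=
      measure_mono (by simpa [hne] using h)
    rw [ae_iff.mp hx] at h1
    exact absurd hz (not_lt.mpr h1)
  rcases this with h | h
  · left; exact ENNReal.toReal_mono (c_ne_top η κ x) (c_step η κ h)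
  · right; exact ENNReal.toReal_mono (c_ne_top η κ z) (c_step η κ h)

include hg in
lemma disj : Pairwise fun z w : {z : E // 0 < η {z}} =>
    Disjoint (Ioc (A η κ z) (B η κ z)) (Ioc (A η κ w) (B η κ w)) := by
  intro z w hne
  rw [Set.disjoint_left]
  intro x h1 h2
  rcases good_pair η κ z.2 (good_atom η κ hg w.2) (fun h => hne (Subtype.ext h)) with h | h
  · linarith [h1.2, h2.1]
  · linarith [h1.1, h2.2]

include hm hg in
lemma atom_supp {z : E} (hz : 0 < η {z}) : ∀ᵐ y ∂κ z, c η κ z ≤ m (Iio y) ∧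
    c η κ z < m (Iic y) ∧ m (Iic y) ≤ c η κ z + η {z} := by
  filter_upwards [formula η κ m hm z (good_atom η κ hg hz), Iic_pos (κ z)] with y hy hpos
  rw [hy.1, hy.2]
  refine ⟨le_self_add, ?_, ?_⟩
  · exact ENNReal.lt_add_right (c_ne_top η κ z) (mul_ne_zero hz.ne' hpos.ne')
  · gcongr
    exact mul_le_of_le_one_right' prob_le_one

include hm in
lemma nonatom {x : E} (hz : ¬ 0 < η {x})
    (hx : ∀ᵐ x' ∂η, x' ≠ x → Below (κ x') (κ x) ∨ Below (κ x) (κ x')) :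
    ∀ᵐ y ∂κ x, m (Iio y) = c η κ x ∧ m (Iic y) = c η κ x := by
  have h0 : η {x} = 0 := by simpa using hz
  filter_upwards [formula η κ m hm x hx] with y hy
  simpa [h0] using hy

lemma meas_F (W : ENNReal) : MeasurableSet {y | m (Iic y) ≤ W} := meas_Iic m measurableSet_Iic
lemma meas_Fm (W : ENNReal) : MeasurableSet {y | W ≤ m (Iio y)} := meas_Iio m measurableSet_Ici

lemma F_le (W : ENNReal) : m {y | m (Iic y) ≤ W} ≤ W :=
  meas_le_of_Iic m (meas_F m W) fun _ hs => hs

lemma Fm_le (W : ENNReal) (hW : W ≤ 1) : m {y | W ≤ m (Iio y)} + W ≤ 1 := by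
  have := meas_le_of_Ici m (meas_Fm m W) (t := 1 - W) fun s hs => by
    have e : Ici s = (Iio s)ᶜ := by simp
    rw [e, prob_compl_eq_one_sub measurableSet_Iio]
    exact tsub_le_tsub_left hs 1
  calc _ ≤ 1 - W + W := by gcongr
    _ = 1 := tsub_add_cancel_of_le hW


lemma p_eq (z : E) : ENNReal.ofReal (B η κ z - A η κ z) = η {z} := by
  rw [B_eq, add_sub_cancel_left, ENNReal.ofReal_toReal (by simp)]

lemma sum_ne_top : (∑' z : {z : E // 0 < η {z}}, η {z.1}) ≠ ⊤ := by
  have := lint_split η (fun _ => 1)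
  simp only [lintegral_const, measure_univ, mul_one] at this
  intro h
  rw [h] at this
  simp at this

include hm hg in
lemma core_adm (w : ℝ) (h0 : 0 ≤ w) (h1 : w ≤ 1)
    (hw : ∀ z : {z : E // 0 < η {z}}, B η κ z ≤ w ∨ w ≤ A η κ z) :
    ∫⁻ x in {z : E | 0 < η {z}}ᶜ, κ x {y | m (Iic y) ≤ ENNReal.ofReal w} ∂η
      = volume (Icc 0 w \ ⋃ z : {z : E // 0 < η {z}}, Ioc (A η κ z) (B η κ z)) := by
  have : Countable {z : E // 0 < η {z}} := (countable_M η).to_subtype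
  set W := ENNReal.ofReal w with hWdef
  have hW1 : W ≤ 1 := by simpa [hWdef] using h1
  set D := {z : E | 0 < η {z}}ᶜ with hD
  have hDm : MeasurableSet D := (countable_M η).measurableSet.compl
  have hvol := vol_adm (fun z : {z : E // 0 < η {z}} => A η κ z) (fun z => B η κ z)
    (fun z => ⟨A_nonneg η κ z, A_lt_B η κ z z.2⟩) (disj η κ hg) w hw
  simp only [p_eq] at hvol
  set V := volume (Icc 0 w \ ⋃ z : {z : E // 0 < η {z}}, Ioc (A η κ z) (B η κ z)) with hV
  set ρ := ∫⁻ x in D, κ x {y | m (Iic y) ≤ W} ∂η with hρ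
  set ρ' := ∫⁻ x in D, κ x {y | W ≤ m (Iio y)} ∂η with hρ'
  set S1 := ∑' z : {z : E // 0 < η {z}}, (if B η κ z ≤ w then η {z.1} else 0) with hS1
  set S2 := ∑' z : {z : E // 0 < η {z}}, (if B η κ z ≤ w then 0 else η {z.1}) with hS2
  have hsum : S1 + S2 = ∑' z : {z : E // 0 < η {z}}, η {z.1} := by
    rw [hS1, hS2, ← ENNReal.tsum_add]
    refine tsum_congr fun z => ?_
    split_ifs <;> simp
  have hSt := sum_ne_top η
  rw [← hsum] at hSt
  have hS1t : S1 ≠ ⊤ := fun h => hSt (by simp [h])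
  have up : S1 + ρ ≤ W := by
    refine le_trans ?_ (F_le m W)
    rw [hm _ (meas_F m W), lint_split η]
    refine add_le_add (ENNReal.tsum_le_tsum fun z => ?_) le_rfl
    split_ifs with h
    · have : κ z {y | m (Iic y) ≤ W} = 1 := by
        rw [← prob_compl_eq_zero_iff (meas_F m W)]
        have h2 : ∀ᵐ y ∂κ z, m (Iic y) ≤ W := by
          filter_upwards [atom_supp η κ m hm hg z.2] with y hy
          refine hy.2.2.trans ?_
          rw [← ofB]; exact ENNReal.ofReal_le_ofReal h
        exact h2
      rw [this, mul_one]
    · exact zero_le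
  have lo : S2 + ρ' + W ≤ 1 := by
    refine le_trans ?_ (Fm_le m W hW1)
    rw [hm _ (meas_Fm m W), lint_split η]
    refine add_le_add (add_le_add (ENNReal.tsum_le_tsum fun z => ?_) le_rfl) le_rfl
    split_ifs with h
    · exact zero_le
    · have : κ z {y | W ≤ m (Iio y)} = 1 := by
        rw [← prob_compl_eq_zero_iff (meas_Fm m W)]
        have h2 : ∀ᵐ y ∂κ z, W ≤ m (Iio y) := by
          filter_upwards [atom_supp η κ m hm hg z.2] with y hy
          refine le_trans ?_ hy.1
          rw [← ofA]; exact ENNReal.ofReal_le_ofReal ((hw z).resolve_left h)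
        exact h2
      rw [this, mul_one]
  have tot : S1 + S2 + η D = 1 := by
    have := lint_split η (fun _ => 1)
    simp only [lintegral_const, measure_univ, mul_one, Measure.restrict_apply_univ] at this
    rw [hsum, this]; simp [hD]
  have hDle : η D ≤ ρ + ρ' := by
    rw [hρ, hρ', ← lintegral_add_left (κ.measurable_coe (meas_F m W))]
    calc η D = ∫⁻ x in D, 1 ∂η := by simp
      _ ≤ _ := by
        refine setLIntegral_mono_ae ((κ.measurable_coe (meas_F m W)).add (κ.measurable_coe (meas_Fm m W))).aemeasurable ?_
        filter_upwards [hg] with x hx hxD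
        calc (1 : ENNReal) = κ x univ := by simp
          _ ≤ κ x ({y | m (Iic y) ≤ W} ∪ {y | W ≤ m (Iio y)}) := by
            refine measure_mono_ae ?_
            filter_upwards [nonatom η κ m hm hxD hx] with y hy _
            change m (Iic y) ≤ W ∨ W ≤ m (Iio y)
            rw [hy.1, hy.2]; exact le_total _ _
          _ ≤ _ := measure_union_le _ _
  have hfin : S2 + ρ' ≠ ⊤ := fun h => by simp [h] at lo
  apply le_antisymm
  · rw [hWdef, ← hvol, add_comm S1 ρ] at up
    exact (ENNReal.add_le_add_iff_right hS1t).mp up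
  · have : V + (S1 + (S2 + ρ')) ≤ ρ + (S1 + (S2 + ρ')) := by
      calc V + (S1 + (S2 + ρ')) = S2 + ρ' + (V + S1) := by ring
        _ ≤ 1 := by rw [hvol, ← hWdef]; exact lo
        _ = S1 + S2 + η D := tot.symm
        _ ≤ S1 + S2 + (ρ + ρ') := by gcongr
        _ = _ := by ring
    exact (ENNReal.add_le_add_iff_right (ENNReal.add_ne_top.mpr ⟨hS1t, hfin⟩)).mp this

include hm hg in
lemma core (w : ℝ) (h0 : 0 ≤ w) (h1 : w ≤ 1) :
    ∫⁻ x in {z : E | 0 < η {z}}ᶜ, κ x {y | m (Iic y) ≤ ENNReal.ofReal w} ∂η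
      = volume (Icc 0 w \ ⋃ z : {z : E // 0 < η {z}}, Ioc (A η κ z) (B η κ z)) := by
  by_cases hw : ∀ z : {z : E // 0 < η {z}}, B η κ z ≤ w ∨ w ≤ A η κ z
  · exact core_adm η κ m hm hg w h0 h1 hw
  push Not at hw
  obtain ⟨z, hz1, hz2⟩ := hw
  have hA := core_adm η κ m hm hg (A η κ z) (A_nonneg η κ z) (by linarith) (fun z' => by
    by_cases h : z' = z
    · subst h; exact Or.inr le_rfl
    · rcases good_pair η κ z'.2 (good_atom η κ hg z.2) (fun e => h (Subtype.ext e)) with h2 | h2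
      · exact Or.inl h2
      · exact Or.inr ((A_lt_B η κ z z.2).le.trans h2))
  have e1 : Icc 0 w \ ⋃ z : {z : E // 0 < η {z}}, Ioc (A η κ z) (B η κ z)
      = Icc 0 (A η κ z) \ ⋃ z : {z : E // 0 < η {z}}, Ioc (A η κ z) (B η κ z) := by
    ext x
    simp only [mem_sdiff, mem_Icc, and_congr_left_iff]
    intro hx
    have : ¬ (A η κ z < x ∧ x ≤ B η κ z) := fun h => hx (mem_iUnion.mpr ⟨z, h⟩)
    constructor
    · rintro ⟨h3, h4⟩
      refine ⟨h3, ?_⟩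
      by_contra h5
      push Not at h5
      exact this ⟨h5, by linarith⟩
    · rintro ⟨h3, h4⟩
      exact ⟨h3, by linarith⟩
  rw [e1, ← hA]
  refine setLIntegral_congr_fun_ae (countable_M η).measurableSet.compl ?_
  filter_upwards [hg] with x hx hxD
  have hne : z.1 ≠ x := by rintro rfl; exact hxD z.2
  refine measure_congr ?_
  filter_upwards [nonatom η κ m hm hxD hx] with y hy
  change (m (Iic y) ≤ _) = (m (Iic y) ≤ _)
  rw [hy.2, ← ofA η κ x, eq_iff_iff, ENNReal.ofReal_le_ofReal_iff h0,
    ENNReal.ofReal_le_ofReal_iff (A_nonneg η κ z)]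
  constructor
  · intro h
    rcases good_pair η κ z.2 hx hne with h2 | h2
    · linarith
    · have : B η κ x = A η κ x + (η {x}).toReal := B_eq η κ x
      have : 0 ≤ (η {x}).toReal := ENNReal.toReal_nonneg
      linarith
  · intro h; linarith

include hm hg in
lemma joint (u v : ℝ) (hu : 0 ≤ u) (hu1 : u ≤ 1) (hv : 0 ≤ v) (hv1 : v ≤ 1) :
    ∫⁻ x, κ x {y | m (Iic y) ≤ ENNReal.ofReal u} * κ x {y | m (Iic y) ≤ ENNReal.ofReal v} ∂η
      = (∑' z : {z : E // 0 < η {z}}, η {z.1} * (κ z {y | m (Iic y) ≤ ENNReal.ofReal u} *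
          κ z {y | m (Iic y) ≤ ENNReal.ofReal v}))
        + volume (Icc 0 (min u v) \ ⋃ z : {z : E // 0 < η {z}}, Ioc (A η κ z) (B η κ z)) := by
  rw [lint_split η, ← core η κ m hm hg (min u v) (le_min hu hv) ((min_le_left _ _).trans hu1)]
  congr 1
  refine setLIntegral_congr_fun_ae (countable_M η).measurableSet.compl ?_
  filter_upwards [hg] with x hx hxD
  have key : ∀ t : ℝ, κ x {y | m (Iic y) ≤ ENNReal.ofReal t} = if c η κ x ≤ ENNReal.ofReal t then 1 else 0 := by
    intro t
    have h := nonatom η κ m hm hxD hx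
    split_ifs with hc
    · rw [← prob_compl_eq_zero_iff (meas_F m _)]
      have h2 : ∀ᵐ y ∂κ x, m (Iic y) ≤ ENNReal.ofReal t := by
        filter_upwards [h] with y hy
        rwa [hy.2]
      exact h2
    · have h2 : ∀ᵐ y ∂κ x, ¬ m (Iic y) ≤ ENNReal.ofReal t := by
        filter_upwards [h] with y hy
        rwa [hy.2]
      rw [ae_iff] at h2
      simpa using h2
  have hmin : ENNReal.ofReal (min u v) = min (ENNReal.ofReal u) (ENNReal.ofReal v) :=
    (ENNReal.ofReal_mono.map_min)
  rw [key, key, key, hmin]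
  simp only [le_min_iff]
  by_cases h1 : c η κ x ≤ ENNReal.ofReal u <;> by_cases h2 : c η κ x ≤ ENNReal.ofReal v <;> simp [h1, h2]

end K2
end OrdSum

/-- If `Y` is completely separated relative to `X`, then the joint distribution function of
the Markov product `(F_Y(Y), F_Y(Y'))` of `(X, F_Y(Y))` admits an ordinal sum structure
`(⟨(a_z, b_z], F_z⟩)_{z ∈ M}` of size `|M|`, `M = {z : ℙ(X = z) > 0}`, with
`b_z − a_z = ℙ(X = z)` and `F_z(u,v) = F_z(u,b_z) · F_z(b_z,v)` on `(a_z, b_z]²`. -/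
theorem ordinal_sum_of_completely_separated {Ω : Type*} [MeasurableSpace Ω]
    [StandardBorelSpace Ω] [Nonempty Ω] {p : ℕ} (μ : Measure Ω) [IsProbabilityMeasure μ]
    (X : Ω → (Fin p → ℝ)) (Y Y' : Ω → ℝ)
    (hX : Measurable X) (hY : Measurable Y) (hY' : Measurable Y')
    (hcopy : IsCondIndepCopy μ X hX Y Y')
    (hsep : CompletelySeparated μ X Y) :
    HasSeparatedOrdinalSum μ X
      (fun u v => (μ {ω | distFun μ Y (Y ω) ≤ u ∧ distFun μ Y (Y' ω) ≤ v}).toReal) := by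
  set η := μ.map X with hη
  set κ := condDistrib Y X μ with hκ
  set m := μ.map Y with hmdef
  have : IsProbabilityMeasure η := Measure.isProbabilityMeasure_map hX.aemeasurable
  have : IsProbabilityMeasure m := Measure.isProbabilityMeasure_map hY.aemeasurable
  have hm : ∀ s, MeasurableSet s → m s = ∫⁻ x, κ x s ∂η := by
    intro s hs
    rw [hmdef, ← condDistrib_comp_map (Y := Y) (X := X) (μ := μ) hX.aemeasurable hY.aemeasurable,
      Measure.bind_apply hs (Kernel.aemeasurable _)]
  have hg : ∀ᵐ x ∂η, ∀ᵐ x' ∂η, x' ≠ x → OrdSum.Below (κ x') (κ x) ∨ OrdSum.Below (κ x) (κ x') := by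
    have h := Measure.ae_ae_of_ae_prod hsep
    filter_upwards [h] with x hx
    filter_upwards [hx] with x' hx' hne
    exact (OrdSum.below_or _ _ (hx' (Ne.symm hne))).symm
  have hF : ∀ y, distFun μ Y y = (m (Iic y)).toReal := by
    intro y
    rw [hmdef, Measure.map_apply hY measurableSet_Iic]; rfl
  have hFm : Measurable (distFun μ Y) := by
    have : distFun μ Y = fun y => (m (Iic y)).toReal := funext hF
    rw [this]; exact (OrdSum.meas_Iic m).ennreal_toReal
  have hset : ∀ u : ℝ, 0 ≤ u → distFun μ Y ⁻¹' Iic u = {y | m (Iic y) ≤ ENNReal.ofReal u} := by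
    intro u hu
    ext y
    change distFun μ Y y ≤ u ↔ m (Iic y) ≤ ENNReal.ofReal u
    rw [hF, ENNReal.le_ofReal_iff_toReal_le (by simp) hu]
  have hsupp : ∀ z : {z : Fin p → ℝ // 0 < η {z}},
      ((κ z).map (distFun μ Y)) (Ioc (OrdSum.A η κ z) (OrdSum.B η κ z)) = 1 := by
    intro z
    rw [Measure.map_apply hFm measurableSet_Ioc,
      ← prob_compl_eq_zero_iff (hFm measurableSet_Ioc)]
    have h2 : ∀ᵐ y ∂κ z, distFun μ Y y ∈ Ioc (OrdSum.A η κ z) (OrdSum.B η κ z) := by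
      filter_upwards [OrdSum.atom_supp η κ m hm hg z.2] with y hy
      rw [hF]
      exact ⟨(ENNReal.toReal_lt_toReal (OrdSum.c_ne_top η κ z) (by simp)).mpr hy.2.1,
        ENNReal.toReal_mono (OrdSum.B_ne η κ z) hy.2.2⟩
    exact h2
  have hprob : ∀ z : {z : Fin p → ℝ // 0 < η {z}}, IsProbabilityMeasure ((κ z).map (distFun μ Y)) :=
    fun z => Measure.isProbabilityMeasure_map hFm.aemeasurable
  refine ⟨fun z => OrdSum.A η κ z, fun z => OrdSum.B η κ z,
    fun z => ((κ z).map (distFun μ Y)).prod ((κ z).map (distFun μ Y)),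
    fun z => ⟨OrdSum.A_nonneg η κ z, OrdSum.A_lt_B η κ z z.2, OrdSum.B_le η κ z⟩,
    OrdSum.disj η κ hg, fun z => inferInstance, fun z => ?_, fun z => ?_, ?_, ?_⟩
  · rw [Measure.prod_prod, hsupp z, mul_one]
  · simp only [OrdSum.B_eq, add_sub_cancel_left]; rfl
  · intro z u hu v hv
    have hB : ((κ z).map (distFun μ Y)) (Iic (OrdSum.B η κ z)) = 1 :=
      le_antisymm prob_le_one (by rw [← hsupp z]; exact measure_mono Ioc_subset_Iic_self)
    simp only [Measure.prod_prod, hB, mul_one, one_mul, ENNReal.toReal_mul]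
  · intro u hu v hv
    have hJ : μ {ω | distFun μ Y (Y ω) ≤ u ∧ distFun μ Y (Y' ω) ≤ v} =
        ∫⁻ x, κ x {y | m (Iic y) ≤ ENNReal.ofReal u} * κ x {y | m (Iic y) ≤ ENNReal.ofReal v} ∂η := by
      have hci := (condIndepFun_iff_map_prod_eq_prod_condDistrib_prod_condDistrib hY hY' hX).mp hcopy.2
      have mu := OrdSum.meas_F m (ENNReal.ofReal u)
      have mv := OrdSum.meas_F m (ENNReal.ofReal v)
      have h1 := congrArg (fun ξ => ξ (univ ×ˢ ({y | m (Iic y) ≤ ENNReal.ofReal u} ×ˢ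
        {y | m (Iic y) ≤ ENNReal.ofReal v}))) hci
      rw [Measure.map_apply (by fun_prop) (MeasurableSet.univ.prod (mu.prod mv)),
        Measure.bind_apply (MeasurableSet.univ.prod (mu.prod mv)) (Kernel.aemeasurable _)] at h1
      have e : {ω | distFun μ Y (Y ω) ≤ u ∧ distFun μ Y (Y' ω) ≤ v} =
          (fun ω => (X ω, Y ω, Y' ω)) ⁻¹' (univ ×ˢ ({y | m (Iic y) ≤ ENNReal.ofReal u} ×ˢ
            {y | m (Iic y) ≤ ENNReal.ofReal v})) := by
        rw [← hset u hu.1, ← hset v hv.1]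
        ext ω; simp
      rw [e, h1]
      refine lintegral_congr_ae ?_
      filter_upwards [hcopy.1] with x hx
      rw [Kernel.prod_apply_prod, Kernel.prod_apply_prod, hx]
      simp [hκ]
    have hj := OrdSum.joint η κ m hm hg u v hu.1 hu.2 hv.1 hv.2
    simp only
    rw [hJ]
    have hfin : ∫⁻ x, κ x {y | m (Iic y) ≤ ENNReal.ofReal u} * κ x {y | m (Iic y) ≤ ENNReal.ofReal v} ∂η ≠ ⊤ := by
      rw [← hJ]; exact measure_ne_top _ _
    rw [hj] at hfin ⊢
    have hfin' := ENNReal.add_ne_top.mp hfin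
    rw [ENNReal.toReal_add hfin'.1 hfin'.2, ENNReal.tsum_toReal_eq (fun z => ENNReal.ne_top_of_tsum_ne_top hfin'.1 z)]
    congr 1
    refine tsum_congr fun z => ?_
    rw [Measure.prod_prod, Measure.map_apply hFm measurableSet_Iic,
      Measure.map_apply hFm measurableSet_Iic, hset u hu.1, hset v hv.1, ENNReal.toReal_mul,
      OrdSum.B_eq, add_sub_cancel_left]
end

section
/- Let (F_Y(Y), F_Y(Y')) be the Markov product of (X, F_Y(Y)) and set M = {z ∈ ℝ^p : ℙ(X = z) > 0}. If the joint distribution function of (F_Y(Y), F_Y(Y')) admits an ordinal sum structure (⟨(a_z,b_z], F_z⟩)_{z∈M} of size |M| such that for every z ∈ M one has b_z − a_z = ℙ(X = z) and F_z(u,v) = F_z(u,b_z)·F_z(b_z,v) for all (u,v) ∈ (a_z,b_z]², then Y is completely separated relative to X. -/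
open MeasureTheory ProbabilityTheory Set

lemma aux_relEffect_s14 (P Q : Measure ℝ) [IsProbabilityMeasure P] [IsProbabilityMeasure Q]
    (F : ℝ → ℝ) (hF : Monotone F) (t : ℝ)
    (hPv : P.real {y | F y ≤ t} = 0 ∨ P.real {y | F y ≤ t} = 1)
    (hQv : Q.real {y | F y ≤ t} = 0 ∨ Q.real {y | F y ≤ t} = 1)
    (hne : P.real {y | F y ≤ t} ≠ Q.real {y | F y ≤ t}) :
    relEffect P Q ∈ ({0, 1} : Set ℝ) := by
  have hm : MeasurableSet {y | F y ≤ t} := measurableSet_le hF.measurable measurable_const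
  have h0 : ∀ (R : Measure ℝ) [IsProbabilityMeasure R], R.real {y | F y ≤ t} = 0 →
      R {y | F y ≤ t} = 0 := by
    intro R _ h
    rwa [measureReal_eq_zero_iff] at h
  have h1 : ∀ (R : Measure ℝ) [IsProbabilityMeasure R], R.real {y | F y ≤ t} = 1 →
      R {y | F y ≤ t}ᶜ = 0 := by
    intro R _ h
    have := probReal_compl_eq_one_sub (μ := R) hm
    rw [h, sub_self] at this
    rwa [measureReal_eq_zero_iff] at this
  rcases hPv with hP | hP <;> rcases hQv with hQ | hQ
  · exact absurd (hP.trans hQ.symm) hne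
  · -- P above, Q below
    left
    have hP0 := h0 P hP
    have hQ0 : ∀ᵐ z ∂Q, F z ≤ t := h1 Q hQ
    unfold relEffect
    rw [integral_eq_zero_of_ae]
    filter_upwards [hQ0] with z hz
    have e1 : P (Iio z) = 0 := measure_mono_null (fun y hy => (hF (le_of_lt hy)).trans hz) hP0
    have e2 : P {z} = 0 := measure_mono_null (fun y hy => by
      rw [mem_singleton_iff.1 hy]; exact hz) hP0
    simp [e1, e2]
  · right
    have hP0 := h1 P hP
    have hQ0 : ∀ᵐ z ∂Q, ¬ F z ≤ t := by
      have := h0 Q hQ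
      rw [ae_iff]; simpa using this
    have : relEffect P Q = ∫ z, (1:ℝ) ∂Q := by
      unfold relEffect
      apply integral_congr_ae
      filter_upwards [hQ0] with z hz
      have e2 : P {z} = 0 := measure_mono_null (fun y hy => by
        rw [mem_singleton_iff.1 hy]; exact hz) hP0
      have e1 : P (Iio z) = 1 := by
        rw [prob_compl_eq_zero_iff measurableSet_Iio |>.symm]
        refine measure_mono_null (fun y hy => ?_) hP0
        intro hy'
        apply hz
        have : z ≤ y := by simpa using hy
        exact (hF this).trans hy'
      simp [e1, e2]
    rw [this]; simp
  · exact absurd (hP.trans hQ.symm) hne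

lemma aux_core {p : ℕ} (P : Measure (Fin p → ℝ)) [IsProbabilityMeasure P]
    (h : ℝ → (Fin p → ℝ) → ℝ) (hm : ∀ t, Measurable (h t))
    (hmono : ∀ x, Monotone fun t => h t x) (hint : ∀ t, Integrable (h t) P)
    (T : Set ℝ) (hT : ∀ t ∈ T, (∀ᵐ x ∂P, h t x = 0 ∨ h t x = 1) ∧ ∫ x, h t x ∂P = t)
    (hT0 : (0:ℝ) ∈ T) (hT1 : (1:ℝ) ∈ T)
    (a b : {z : Fin p → ℝ // 0 < P {z}} → ℝ)
    (ha : ∀ z, a z ∈ T) (hb : ∀ z, b z ∈ T) (hab : ∀ z, a z < b z)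
    (hlen : ∀ z, b z - a z = (P {z.1}).toReal)
    (hgap : ∀ m ∈ Icc (0:ℝ) 1, m ∉ T → ∃ z, m ∈ Ioo (a z) (b z)) :
    ∀ᵐ q ∂(P.prod P), q.1 ≠ q.2 → ∃ t, (h t q.1 = 0 ∨ h t q.1 = 1) ∧
      (h t q.2 = 0 ∨ h t q.2 = 1) ∧ h t q.1 ≠ h t q.2 := by
  classical
  have hcount : Countable {z : Fin p → ℝ // 0 < P {z}} := by
    have := Measure.countable_meas_level_set_pos (μ := P) (g := fun x : Fin p → ℝ => x)
      measurable_id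
    have h2 : ({z : Fin p → ℝ | 0 < P {z}}).Countable := by simpa using this
    exact h2.to_subtype
  obtain ⟨D0, hD0T, hD0c, hD0d⟩ :=
    (TopologicalSpace.IsSeparable.of_separableSpace T).exists_countable_dense_subset
  set D : Set ℝ := D0 ∪ (range a ∪ range b ∪ {0, 1}) with hD
  have hDc : D.Countable := hD0c.union
    (((countable_range a).union (countable_range b)).union (by simp))
  have hDT : D ⊆ T := by
    rintro t (ht | (⟨z, rfl⟩ | ⟨z, rfl⟩) | (rfl | rfl))
    · exact hD0T ht
    · exact ha z
    · exact hb z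
    · exact hT0
    · exact hT1
  have haD : ∀ z, a z ∈ D := fun z => Or.inr (Or.inl (Or.inl ⟨z, rfl⟩))
  have hbD : ∀ z, b z ∈ D := fun z => Or.inr (Or.inl (Or.inr ⟨z, rfl⟩))
  have h0D : (0:ℝ) ∈ D := Or.inr (Or.inr (by simp))
  have h1D : (1:ℝ) ∈ D := Or.inr (Or.inr (by simp))
  have hK : ∀ᵐ x ∂P, ∀ t ∈ D, h t x = 0 ∨ h t x = 1 := by
    rw [ae_ball_iff hDc]
    exact fun t ht => (hT t (hDT ht)).1
  -- measure of strips
  have hstrip : ∀ s ∈ D, ∀ t ∈ D, s ≤ t →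
      P {x | h s x = 0 ∧ h t x = 1} ≤ ENNReal.ofReal (t - s) := by
    intro s hs t ht hst
    have hms : MeasurableSet {x | h s x = 0 ∧ h t x = 1} :=
      ((hm s) (measurableSet_singleton 0)).inter ((hm t) (measurableSet_singleton 1))
    have e : ∫ x, (h t x - h s x) ∂P = t - s := by
      rw [integral_sub (hint t) (hint s), (hT t (hDT ht)).2, (hT s (hDT hs)).2]
    have e2 : P.real {x | h s x = 0 ∧ h t x = 1} ≤ t - s := by
      rw [← e, ← integral_indicator_one hms]
      apply integral_mono ((integrable_const (1:ℝ)).indicator hms) ((hint t).sub (hint s))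
      intro x
      by_cases hx : x ∈ {x | h s x = 0 ∧ h t x = 1}
      · simp only [indicator_of_mem hx]
        rcases hx with ⟨h1, h2⟩
        simp [h1, h2]
      · simp only [indicator_of_notMem hx]
        have := hmono x hst
        simp only at this
        simp only [Pi.sub_apply]; linarith
    rw [← ofReal_measureReal]
    exact ENNReal.ofReal_le_ofReal e2
  set S : {z : Fin p → ℝ // 0 < P {z}} → Set (Fin p → ℝ) :=
    fun z => {x | h (a z) x = 0 ∧ h (b z) x = 1} with hS
  have hSm : ∀ z, MeasurableSet (S z) := fun z =>
    ((hm _) (measurableSet_singleton 0)).inter ((hm _) (measurableSet_singleton 1))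
  have hlen' : ∀ z, ENNReal.ofReal (b z - a z) = P {z.1} := by
    intro z; rw [hlen z, ENNReal.ofReal_toReal (measure_ne_top _ _)]
  set E : Set ((Fin p → ℝ) × (Fin p → ℝ)) := {q | ∀ t ∈ D, h t q.1 = h t q.2} with hE
  have hEm : MeasurableSet E := by
    have : E = ⋂ t ∈ D, {q | h t q.1 = h t q.2} := by ext; simp [hE]
    rw [this]
    refine MeasurableSet.biInter hDc fun t _ => ?_
    exact measurableSet_eq_fun ((hm t).comp measurable_fst) ((hm t).comp measurable_snd)
  have hclass : ∀ᵐ x ∂P, P (Prod.mk x ⁻¹' E) ≤ ∑' z, (S z).indicator (fun _ => P {z.1}) x := by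
    have hz0 : ∀ᵐ x ∂P, h 0 x = 0 := by
      have hnn : P {x | h 0 x = 1} = 0 := by
        have hms : MeasurableSet {x | h 0 x = 1} := (hm 0) (measurableSet_singleton 1)
        have : P.real {x | h 0 x = 1} ≤ 0 := by
          refine le_of_le_of_eq ?_ (hT 0 hT0).2
          rw [← integral_indicator_one hms]
          apply integral_mono_ae ((integrable_const (1:ℝ)).indicator hms) (hint 0)
          filter_upwards [(hT 0 hT0).1] with x hx
          rcases hx with hx | hx <;> simp [indicator, hx]
        have := le_antisymm this measureReal_nonneg
        rwa [measureReal_eq_zero_iff] at this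
      have : ∀ᵐ x ∂P, ¬ h 0 x = 1 := by rw [ae_iff]; simpa using hnn
      filter_upwards [(hT 0 hT0).1, this] with x hx hx'
      exact hx.resolve_right hx'
    have hz1 : ∀ᵐ x ∂P, h 1 x = 1 := by
      have hms : MeasurableSet {x | h 1 x = 1} := (hm 1) (measurableSet_singleton 1)
      have : 1 ≤ P.real {x | h 1 x = 1} := by
        refine le_of_eq_of_le (hT 1 hT1).2.symm ?_
        rw [← integral_indicator_one hms]
        apply integral_mono_ae (hint 1) ((integrable_const (1:ℝ)).indicator hms)
        filter_upwards [(hT 1 hT1).1] with x hx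
        rcases hx with hx | hx <;> simp [indicator, hx]
      have h2 := probReal_compl_eq_one_sub (μ := P) hms
      have h3 : P.real {x | h 1 x = 1}ᶜ = 0 := le_antisymm (by linarith) measureReal_nonneg
      rwa [measureReal_eq_zero_iff] at h3
    filter_upwards [hK, hz0, hz1] with x hx hx0 hx1
    by_cases hC : P (Prod.mk x ⁻¹' E) = 0
    · rw [hC]; exact zero_le
    set ε := P.real (Prod.mk x ⁻¹' E) with hε
    have hεpos : 0 < ε := by
      rw [hε, measureReal_def]; exact ENNReal.toReal_pos hC (measure_ne_top _ _)
    have hsub : ∀ s ∈ D, ∀ t ∈ D, h s x = 0 → h t x = 1 → s + ε ≤ t := by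
      intro s hs t ht h1 h2
      have hst : s ≤ t := by
        by_contra hlt
        have := hmono x (le_of_not_ge hlt)
        simp only [h1, h2] at this
        linarith
      have h3 : P (Prod.mk x ⁻¹' E) ≤ ENNReal.ofReal (t - s) := by
        refine (measure_mono fun y hy => ?_).trans (hstrip s hs t ht hst)
        exact ⟨(hy s hs).symm.trans h1, (hy t ht).symm.trans h2⟩
      have := ENNReal.toReal_le_of_le_ofReal (by linarith) h3
      rw [← measureReal_def] at this
      linarith
    set A : Set ℝ := {s | s ∈ D ∧ h s x = 0} with hA
    have hAne : A.Nonempty := ⟨0, h0D, hx0⟩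
    have hAb : BddAbove A := ⟨1, fun s hs => by
      have := hsub s hs.1 1 h1D hs.2 hx1; linarith⟩
    set m := sSup A + ε / 2 with hmdef
    have hlow : ∀ s ∈ D, h s x = 0 → s ≤ m - ε / 2 := by
      intro s hs h1
      have := le_csSup hAb (show s ∈ A from ⟨hs, h1⟩)
      linarith
    have hhigh : ∀ t ∈ D, h t x = 1 → m + ε / 2 ≤ t := by
      intro t ht h1
      have : sSup A ≤ t - ε := csSup_le hAne fun s hs => by
        have := hsub s hs.1 t ht hs.2 h1; linarith
      linarith
    have hmT : m ∉ T := by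
      intro hmT
      obtain ⟨d, hd, hdist⟩ := Metric.mem_closure_iff.1 (hD0d hmT) (ε / 2) (by linarith)
      rw [Real.dist_eq, abs_lt] at hdist
      rcases hx d (Or.inl hd) with h1 | h1
      · have := hlow d (Or.inl hd) h1; linarith
      · have := hhigh d (Or.inl hd) h1; linarith
    obtain ⟨z, hz⟩ := hgap m ⟨by have := hlow 0 h0D hx0; linarith,
      by have := hhigh 1 h1D hx1; linarith⟩ hmT
    have hza : h (a z) x = 0 := by
      refine (hx _ (haD z)).resolve_right fun h1 => ?_
      have := hhigh _ (haD z) h1; linarith [hz.1]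
    have hzb : h (b z) x = 1 := by
      refine (hx _ (hbD z)).resolve_left fun h1 => ?_
      have := hlow _ (hbD z) h1; linarith [hz.2]
    refine le_trans ?_ (ENNReal.le_tsum z)
    rw [indicator_of_mem (show x ∈ S z from ⟨hza, hzb⟩), ← hlen']
    refine (measure_mono fun y hy => ?_).trans (hstrip _ (haD z) _ (hbD z) (hab z).le)
    exact ⟨(hy _ (haD z)).symm.trans hza, (hy _ (hbD z)).symm.trans hzb⟩
  set Δ : Set ((Fin p → ℝ) × (Fin p → ℝ)) := {q | q.1 = q.2} with hΔ
  have hΔm : MeasurableSet Δ := measurableSet_eq_fun measurable_fst measurable_snd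
  have hPE : P.prod P E ≤ ∑' z : {z : Fin p → ℝ // 0 < P {z}}, P {z.1} * P {z.1} := by
    rw [Measure.prod_apply hEm]
    refine (lintegral_mono_ae hclass).trans ?_
    rw [lintegral_tsum fun z => (measurable_const.indicator (hSm z)).aemeasurable]
    refine ENNReal.tsum_le_tsum fun z => ?_
    rw [lintegral_indicator_const (hSm z)]
    refine mul_le_mul_right ?_ _
    refine le_of_le_of_eq ?_ (hlen' z)
    exact hstrip _ (haD z) _ (hbD z) (hab z).le
  have hPΔ : ∑' z : {z : Fin p → ℝ // 0 < P {z}}, P {z.1} * P {z.1} ≤ P.prod P Δ := by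
    have hdis : Pairwise (Function.onFun Disjoint
        fun z : {z : Fin p → ℝ // 0 < P {z}} => ({(z.1, z.1)} : Set ((Fin p → ℝ) × (Fin p → ℝ)))) := by
      intro z w hzw
      simp only [Function.onFun, disjoint_singleton, ne_eq, Prod.mk.injEq, and_self]
      exact fun h => hzw (Subtype.ext h)
    have := measure_iUnion (μ := P.prod P) hdis fun z => measurableSet_singleton _
    have e : ∀ z : {z : Fin p → ℝ // 0 < P {z}}, P.prod P {(z.1, z.1)} = P {z.1} * P {z.1} := by
      intro z
      rw [← singleton_prod_singleton, Measure.prod_prod]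
    simp only [e] at this
    rw [← this]
    apply measure_mono
    intro q hq
    obtain ⟨z, hz⟩ := mem_iUnion.1 hq
    rw [mem_singleton_iff.1 hz]; rfl
  have hΔE : Δ ⊆ E := by
    intro q hq t _
    rw [show q.1 = q.2 from hq]
  have hnull : P.prod P (E \ Δ) = 0 := by
    rw [measure_sdiff hΔE hΔm.nullMeasurableSet (measure_ne_top _ _)]
    exact tsub_eq_zero_of_le (hPE.trans hPΔ)
  have hnull' : ∀ᵐ q ∂(P.prod P), q ∉ E \ Δ := measure_eq_zero_iff_ae_notMem.1 hnull
  have k1 : ∀ᵐ q ∂(P.prod P), ∀ t ∈ D, h t q.1 = 0 ∨ h t q.1 = 1 :=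
    Measure.quasiMeasurePreserving_fst.ae hK
  have k2 : ∀ᵐ q ∂(P.prod P), ∀ t ∈ D, h t q.2 = 0 ∨ h t q.2 = 1 :=
    Measure.quasiMeasurePreserving_snd.ae hK
  filter_upwards [hnull', k1, k2] with q hq hq1 hq2 hne
  have : q ∉ E := fun hqE => hq ⟨hqE, hne⟩
  simp only [hE, mem_ofPred_eq, not_forall] at this
  obtain ⟨t, ht, hne'⟩ := this
  exact ⟨t, hq1 t ht, hq2 t ht, hne'⟩

lemma aux_condIndep {Ω : Type*} [MeasurableSpace Ω]
    [StandardBorelSpace Ω] [Nonempty Ω] {p : ℕ} (μ : Measure Ω) [IsProbabilityMeasure μ]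
    (X : Ω → (Fin p → ℝ)) (Y Y' : Ω → ℝ)
    (hX : Measurable X) (hY : Measurable Y) (hY' : Measurable Y')
    (hcopy : IsCondIndepCopy μ X hX Y Y') (s : Set ℝ) (hs : MeasurableSet s) :
    ∫ x, (condDistrib Y X μ x).real s ∂(μ.map X) = μ.real (Y ⁻¹' s) ∧
    ∫ x, (condDistrib Y X μ x).real s ^ 2 ∂(μ.map X) = μ.real (Y ⁻¹' s ∩ Y' ⁻¹' s) := by
  have hmeas : Measurable fun x => (condDistrib Y X μ x).real s :=
    ((condDistrib Y X μ).measurable_coe hs).ennreal_toReal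
  have e1 := condDistrib_ae_eq_condExp (μ := μ) hX hY hs
  have e2 := condDistrib_ae_eq_condExp (μ := μ) hX hY' hs
  have e3 := (condIndepFun_iff_condExp_inter_preimage_eq_mul hY hY').1 hcopy.2 s s hs hs
  have e4 := ae_of_ae_map hX.aemeasurable hcopy.1
  constructor
  · rw [integral_map hX.aemeasurable hmeas.aestronglyMeasurable, integral_congr_ae e1,
      integral_condExp hX.comap_le, ← integral_indicator_one (hY hs)]
    rfl
  · rw [integral_map hX.aemeasurable (hmeas.pow_const 2).aestronglyMeasurable]
    have : (fun ω => (condDistrib Y X μ (X ω)).real s ^ 2) =ᵐ[μ]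
        (μ⟦Y ⁻¹' s ∩ Y' ⁻¹' s | MeasurableSpace.comap X inferInstance⟧) := by
      filter_upwards [e1, e2, e3, e4] with ω h1 h2 h3 h4
      rw [h3, ← h1, ← h2, h4, sq]
    rw [integral_congr_ae this, integral_condExp hX.comap_le,
      ← integral_indicator_one ((hY hs).inter (hY' hs))]
    rfl

lemma aux_sum {ι : Type*} [Countable ι] (a b : ι → ℝ) (hab : ∀ z, 0 ≤ a z ∧ a z < b z ∧ b z ≤ 1)
    (hdis : Pairwise fun z w => Disjoint (Set.Ioc (a z) (b z)) (Set.Ioc (a w) (b w)))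
    (t : ℝ) (ht0 : 0 ≤ t) (hcut : ∀ z, b z ≤ t ∨ t ≤ a z) :
    (∑' z, (b z - a z) * (if b z ≤ t then (1:ℝ) else 0))
      + (volume (Set.Icc 0 t \ ⋃ z, Set.Ioc (a z) (b z))).toReal = t := by
  have hU : MeasurableSet (⋃ z, Ioc (a z) (b z)) := MeasurableSet.iUnion fun z => measurableSet_Ioc
  have h1 := measure_inter_add_sdiff (μ := (volume : Measure ℝ)) (Icc 0 t) hU
  rw [inter_iUnion, measure_iUnion (fun z w hzw => ((hdis hzw).mono inter_subset_right
    inter_subset_right)) (fun z => measurableSet_Icc.inter measurableSet_Ioc)] at h1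
  have h2 : ∀ z, volume (Icc 0 t ∩ Ioc (a z) (b z))
      = ENNReal.ofReal ((b z - a z) * (if b z ≤ t then (1:ℝ) else 0)) := by
    intro z
    obtain ⟨h0, h1, h2⟩ := hab z
    rcases hcut z with h | h
    · rw [if_pos h, mul_one, inter_eq_right.2, Real.volume_Ioc]
      exact fun y hy => ⟨h0.trans hy.1.le, hy.2.trans h⟩
    · rw [if_neg (by linarith), mul_zero, ENNReal.ofReal_zero]
      convert! measure_empty (μ := (volume : Measure ℝ))
      ext y; simp; intros; linarith
  simp_rw [h2] at h1
  have hne := measure_ne_top_of_subset (μ := (volume : Measure ℝ))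
    (sdiff_subset (s := Icc 0 t) (t := ⋃ z, Ioc (a z) (b z))) (by simp)
  have hne2 : ∑' z, ENNReal.ofReal ((b z - a z) * (if b z ≤ t then (1:ℝ) else 0)) ≠ ⊤ := by
    intro h
    rw [h] at h1; simp at h1
  have h3 := congrArg ENNReal.toReal h1
  rw [ENNReal.toReal_add hne2 hne, ENNReal.tsum_toReal_eq (by simp)] at h3
  rw [Real.volume_Icc, ENNReal.toReal_ofReal (by linarith), sub_zero] at h3
  refine Eq.trans ?_ h3
  congr 2
  ext z
  rw [ENNReal.toReal_ofReal]
  have := hab z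
  exact mul_nonneg (by linarith) (by split_ifs <;> norm_num)

/-- If the joint distribution function of the Markov product `(F_Y(Y), F_Y(Y'))` of
`(X, F_Y(Y))` admits an ordinal sum structure `(⟨(a_z, b_z], F_z⟩)_{z ∈ M}` of size `|M|`,
`M = {z : ℙ(X = z) > 0}`, with `b_z − a_z = ℙ(X = z)` and
`F_z(u,v) = F_z(u,b_z) · F_z(b_z,v)` on `(a_z, b_z]²`, then `Y` is completely separated
relative to `X`. -/
theorem completely_separated_of_ordinal_sum {Ω : Type*} [MeasurableSpace Ω]
    [StandardBorelSpace Ω] [Nonempty Ω] {p : ℕ} (μ : Measure Ω) [IsProbabilityMeasure μ]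
    (X : Ω → (Fin p → ℝ)) (Y Y' : Ω → ℝ)
    (hX : Measurable X) (hY : Measurable Y) (hY' : Measurable Y')
    (hcopy : IsCondIndepCopy μ X hX Y Y')
    (hsum : HasSeparatedOrdinalSum μ X
      (fun u v => (μ {ω | distFun μ Y (Y ω) ≤ u ∧ distFun μ Y (Y' ω) ≤ v}).toReal)) :
    CompletelySeparated μ X Y := by
  obtain ⟨a, b, ν, hab, hdis, hν, hνs, hlen, -, hG⟩ := hsum
  have : IsProbabilityMeasure (μ.map X) := Measure.isProbabilityMeasure_map hX.aemeasurable
  have hcount : Countable {z : Fin p → ℝ // 0 < μ.map X {z}} := by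
    have := Measure.countable_meas_level_set_pos (μ := μ.map X) (g := fun x : Fin p → ℝ => x)
      measurable_id
    have h2 : ({z : Fin p → ℝ | 0 < μ.map X {z}}).Countable := by simpa using this
    exact h2.to_subtype
  set F := distFun μ Y with hFdef
  have hF : Monotone F := by
    intro y y' hyy
    apply ENNReal.toReal_mono (measure_ne_top _ _)
    exact measure_mono fun ω hω => le_trans hω hyy
  have hF1 : ∀ y, F y ≤ 1 := fun y => measureReal_le_one (μ := μ)
  have hms : ∀ t, MeasurableSet {y | F y ≤ t} :=
    fun t => measurableSet_le hF.measurable measurable_const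
  set h : ℝ → (Fin p → ℝ) → ℝ := fun t x => (condDistrib Y X μ x).real {y | F y ≤ t} with hh
  have hhm : ∀ t, Measurable (h t) := fun t =>
    ((condDistrib Y X μ).measurable_coe (hms t)).ennreal_toReal
  have hh0 : ∀ t x, 0 ≤ h t x := fun t x => measureReal_nonneg
  have hh1 : ∀ t x, h t x ≤ 1 := fun t x => measureReal_le_one
  have hint : ∀ t, Integrable (h t) (μ.map X) := fun t =>
    Integrable.of_bound (hhm t).aestronglyMeasurable 1 (Filter.Eventually.of_forall fun x => by
      rw [Real.norm_eq_abs, abs_of_nonneg (hh0 t x)]; exact hh1 t x)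
  have hint2 : ∀ t, Integrable (fun x => h t x ^ 2) (μ.map X) := fun t =>
    Integrable.of_bound ((hhm t).pow_const 2).aestronglyMeasurable 1
      (Filter.Eventually.of_forall fun x => by
        rw [Real.norm_eq_abs, abs_of_nonneg (sq_nonneg _)]
        exact pow_le_one₀ (hh0 t x) (hh1 t x))
  set T : Set ℝ := {t | t ∈ Icc (0:ℝ) 1 ∧ ∀ z, b z ≤ t ∨ t ≤ a z} with hTdef
  have hνval : ∀ t, (∀ z, b z ≤ t ∨ t ≤ a z) → ∀ v, (v = 1 ∨ v = t) → ∀ z,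
      (ν z (Iic t ×ˢ Iic v)).toReal = if b z ≤ t then 1 else 0 := by
    intro t hcut v hv z
    have := hν z
    obtain ⟨h0, h1, h2⟩ := hab z
    rcases hcut z with hz | hz
    · rw [if_pos hz]
      have : ν z (Iic t ×ˢ Iic v) = 1 := by
        apply le_antisymm prob_le_one
        rw [← hνs z]
        apply measure_mono
        apply prod_mono
        · exact fun y hy => hy.2.trans hz
        · refine fun y hy => hy.2.trans ?_
          rcases hv with rfl | rfl <;> assumption
      rw [this]; simp
    · rw [if_neg (by linarith)]
      have : ν z (Iic t ×ˢ Iic v) = 0 := by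
        have hc : ν z (Ioc (a z) (b z) ×ˢ Ioc (a z) (b z))ᶜ = 0 :=
          (prob_compl_eq_zero_iff (measurableSet_Ioc.prod measurableSet_Ioc)).2 (hνs z)
        refine measure_mono_null ?_ hc
        intro q hq hq'
        have i1 : q.1 ≤ t := hq.1
        have i2 : a z < q.1 := hq'.1.1
        linarith
      rw [this]; simp
  have hGval : ∀ t ∈ T, ∀ v, (v = 1 ∨ v = t) →
      (μ {ω | F (Y ω) ≤ t ∧ F (Y' ω) ≤ v}).toReal = t := by
    intro t ht v hv
    have hvI : v ∈ Icc (0:ℝ) 1 := by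
      rcases hv with rfl | rfl
      · simp
      · exact ht.1
    refine (hG t ht.1 v hvI).trans ?_
    simp_rw [hνval t ht.2 v hv]
    have : min t v = t := by
      rcases hv with rfl | rfl
      · exact min_eq_left ht.1.2
      · simp
    rw [this]
    exact aux_sum a b hab hdis t ht.1.1 ht.2
  have hT : ∀ t ∈ T, (∀ᵐ x ∂(μ.map X), h t x = 0 ∨ h t x = 1) ∧ ∫ x, h t x ∂(μ.map X) = t := by
    intro t ht
    obtain ⟨i1, i2⟩ := aux_condIndep μ X Y Y' hX hY hY' hcopy {y | F y ≤ t} (hms t)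
    have j1 : ∫ x, h t x ∂(μ.map X) = t := by
      rw [hh]; simp only; rw [i1]
      have := hGval t ht 1 (Or.inl rfl)
      simp only [hF1, and_true] at this
      exact this
    have j2 : ∫ x, h t x ^ 2 ∂(μ.map X) = t := by
      rw [hh]; simp only; rw [i2]
      exact hGval t ht t (Or.inr rfl)
    refine ⟨?_, j1⟩
    have j3 : ∫ x, (h t x - h t x ^ 2) ∂(μ.map X) = 0 := by
      rw [integral_sub (hint t) (hint2 t), j1, j2, sub_self]
    have j4 := (integral_eq_zero_iff_of_nonneg (f := fun x => h t x - h t x ^ 2) (fun x => by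
      have := hh0 t x
      have := hh1 t x
      simp only [Pi.zero_apply]; nlinarith) ((hint t).sub (hint2 t))).1 j3
    filter_upwards [j4] with x hx
    simp only [Pi.zero_apply] at hx
    have : h t x * (1 - h t x) = 0 := by linarith
    rcases mul_eq_zero.1 this with h | h
    · exact Or.inl h
    · right; linarith
  have hdis' : ∀ z w, z ≠ w → b z ≤ a w ∨ b w ≤ a z := by
    intro z w hzw
    have h1 := hab z
    have h2 := hab w
    have := Ioc_disjoint_Ioc.1 (hdis hzw)
    grind
  have key := aux_core (μ.map X) h hhm
    (fun x s t hst => measureReal_mono (fun y hy => le_trans hy hst))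
    hint T hT ⟨by simp, fun z => Or.inr (hab z).1⟩ ⟨by simp, fun z => Or.inl (hab z).2.2⟩ a b
    (fun z => ⟨⟨(hab z).1, (hab z).2.1.le.trans (hab z).2.2⟩, fun w => by
      have := hab z
      have := hab w
      by_cases hzw : z = w
      · subst hzw; simp
      · rcases hdis' z w hzw with h | h
        · right; linarith
        · left; exact h⟩)
    (fun z => ⟨⟨(hab z).1.trans (hab z).2.1.le, (hab z).2.2⟩, fun w => by
      have := hab z
      have := hab w
      by_cases hzw : z = w
      · subst hzw; simp
      · rcases hdis' z w hzw with h | h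
        · right; linarith
        · left; linarith⟩)
    (fun z => (hab z).2.1) hlen (by
      intro m hm hmT
      by_contra hcon
      push Not at hcon
      apply hmT
      refine ⟨hm, fun z => ?_⟩
      by_contra hc
      push Not at hc
      exact hcon z ⟨hc.2, hc.1⟩)
  unfold CompletelySeparated
  filter_upwards [key] with q hq hne
  obtain ⟨t, h1, h2, h3⟩ := hq hne
  exact aux_relEffect_s14 _ _ F hF t h1 h2 h3
end

section
/- Suppose at least one coordinate of X has a continuous distribution function, and let (F_Y(Y), F_Y(Y')) be the Markov product of (X, F_Y(Y)). Then {z ∈ ℝ^p : ℙ(X = z) > 0} = ∅, and Y is completely separated relative to X if and only if ℙ(F_Y(Y) ≤ u, F_Y(Y') ≤ v) = min{u,v} for all (u,v) ∈ [0,1]², i.e. if and only if (F_Y(Y), F_Y(Y')) admits an ordinal sum structure of size 0. -/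
open MeasureTheory ProbabilityTheory Set

lemma aux_cdf_cont_iff (m : Measure ℝ) [IsProbabilityMeasure m] :
    Continuous (cdf m) ↔ ∀ a, m {a} = 0 := by
  have h : ∀ a, m {a} = ENNReal.ofReal (cdf m a - Function.leftLim (cdf m) a) := fun a => by
    conv_lhs => rw [← measure_cdf m]
    rw [StieltjesFunction.measure_singleton]
  constructor
  · intro hc a
    rw [h, (hc.continuousAt.continuousWithinAt).leftLim_eq]; simp
  · intro ha
    rw [continuous_iff_continuousAt]
    intro a
    rw [(cdf m).mono.continuousAt_iff_leftLim_eq_rightLim, StieltjesFunction.rightLim_eq]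
    have h1 := ha a
    rw [h, ENNReal.ofReal_eq_zero] at h1
    have := (cdf m).mono.leftLim_le (le_refl a)
    linarith

lemma aux_uniform (m : Measure ℝ) [IsProbabilityMeasure m] (ha : ∀ a, m {a} = 0)
    (u : ℝ) (hu : u ∈ Icc (0:ℝ) 1) : m.real {y | cdf m y ≤ u} = u := by
  have hc := (aux_cdf_cont_iff m).2 ha
  have main : ∀ u ∈ Ioo (0:ℝ) 1, m.real {y | cdf m y ≤ u} = u := by
    intro u hu
    obtain ⟨s, hs⟩ : ∃ s, cdf m s = u := by
      have h1 : ∃ a, cdf m a < u := ((tendsto_cdf_atBot m).eventually (gt_mem_nhds hu.1)).exists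
      have h2 : ∃ a, u < cdf m a := ((tendsto_cdf_atTop m).eventually (lt_mem_nhds hu.2)).exists
      obtain ⟨a, h1⟩ := h1
      obtain ⟨b, h2⟩ := h2
      exact mem_range_of_exists_le_of_exists_ge hc ⟨a, h1.le⟩ ⟨b, h2.le⟩
    apply le_antisymm
    · have hcl : IsClosed {y | cdf m y ≤ u} := isClosed_le hc continuous_const
      have hne : {y | cdf m y ≤ u}.Nonempty := ⟨s, hs.le⟩
      have hbd : BddAbove {y | cdf m y ≤ u} := by
        obtain ⟨b, h2⟩ : ∃ a, u < cdf m a :=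
          ((tendsto_cdf_atTop m).eventually (lt_mem_nhds hu.2)).exists
        refine ⟨b, fun y hy => ?_⟩
        by_contra hlt
        have := monotone_cdf m (not_le.1 hlt).le
        simp only [mem_ofPred_eq] at hy
        linarith
      have hmem := hcl.csSup_mem hne hbd
      calc m.real {y | cdf m y ≤ u} ≤ m.real (Iic (sSup {y | cdf m y ≤ u})) :=
            measureReal_mono (fun y hy => le_csSup hbd hy)
        _ = cdf m (sSup {y | cdf m y ≤ u}) := (cdf_eq_real m _).symm
        _ ≤ u := hmem
    · calc u = m.real (Iic s) := by rw [← cdf_eq_real, hs]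
        _ ≤ _ := measureReal_mono (fun y hy => (monotone_cdf m hy).trans hs.le)
  rcases eq_or_lt_of_le hu.1 with h0 | h0
  · subst h0
    apply le_antisymm _ measureReal_nonneg
    apply le_of_forall_pos_le_add
    intro e he
    have he' : min e (1/2) ∈ Ioo (0:ℝ) 1 :=
      ⟨by positivity, lt_of_le_of_lt (min_le_right _ _) (by norm_num)⟩
    calc m.real {y | cdf m y ≤ 0} ≤ m.real {y | cdf m y ≤ min e (1/2)} :=
          measureReal_mono (fun y hy => le_trans hy he'.1.le)
      _ = min e (1/2) := main _ he'
      _ ≤ 0 + e := by simp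
  · rcases eq_or_lt_of_le hu.2 with h1 | h1
    · subst h1
      simp [cdf_le_one]
    · exact main u ⟨h0, h1⟩

lemma aux_integrand (m : Measure ℝ) [IsProbabilityMeasure m] :
    Measurable (fun z => (m (Set.Iio z)).toReal + (1 / 2) * (m {z}).toReal) ∧
    (∀ z, (m (Set.Iio z)).toReal + (m {z}).toReal = m.real (Iic z)) ∧
    (∀ n : Measure ℝ, IsProbabilityMeasure n →
      Integrable (fun z => (m (Set.Iio z)).toReal + (1 / 2) * (m {z}).toReal) n) := by
  have h2 : ∀ z, (m (Set.Iio z)).toReal + (m {z}).toReal = m.real (Iic z) := by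
    intro z
    change m.real _ + m.real _ = _
    rw [← measureReal_union (by simp) (measurableSet_singleton z), Iio_union_right]
  have hmono : Monotone fun z => m.real (Iio z) := fun a b h => measureReal_mono (Iio_subset_Iio h)
  have hmono2 : Monotone fun z => m.real (Iic z) := fun a b h => measureReal_mono (Iic_subset_Iic.2 h)
  have h1 : Measurable (fun z => (m (Set.Iio z)).toReal + (1 / 2) * (m {z}).toReal) := by
    have : (fun z => (m (Set.Iio z)).toReal + (1 / 2) * (m {z}).toReal)
        = fun z => m.real (Iio z) + 1/2 * (m.real (Iic z) - m.real (Iio z)) := by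
      funext z; rw [← h2 z]; simp [Measure.real]
    rw [this]
    exact hmono.measurable.add ((hmono2.measurable.sub hmono.measurable).const_mul _)
  refine ⟨h1, h2, fun n hn => ?_⟩
  refine Integrable.of_bound h1.aestronglyMeasurable 1 (Filter.Eventually.of_forall fun z => ?_)
  have h3 := h2 z
  have h4 : m.real (Iic z) ≤ 1 := measureReal_le_one
  have h5 : 0 ≤ (m (Set.Iio z)).toReal := ENNReal.toReal_nonneg
  have h6 : 0 ≤ (m {z}).toReal := ENNReal.toReal_nonneg
  rw [Real.norm_of_nonneg (by positivity)]
  linarith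

lemma aux_rel_false (m n : Measure ℝ) [IsProbabilityMeasure m] [IsProbabilityMeasure n]
    (h : relEffect m n ∈ ({0, 1} : Set ℝ)) (B C : Set ℝ)
    (hBC : ∀ b ∈ B, ∀ c ∈ C, b ≤ c)
    (hmB : m B ≠ 0) (hmC : m C ≠ 0) (hnB : n B ≠ 0) (hnC : n C ≠ 0) : False := by
  obtain ⟨hm, h2, hi⟩ := aux_integrand m
  have hi := hi n inferInstance
  have h5 : ∀ z, 0 ≤ (m (Set.Iio z)).toReal := fun z => ENNReal.toReal_nonneg
  have h6 : ∀ z, 0 ≤ (m {z}).toReal := fun z => ENNReal.toReal_nonneg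
  have h4 : ∀ z, m.real (Iic z) ≤ 1 := fun z => measureReal_le_one
  rcases h with h | h
  · rw [relEffect, integral_eq_zero_iff_of_nonneg
      (fun z => by have := h5 z; have := h6 z; simp only [Pi.zero_apply]; positivity) hi] at h
    obtain ⟨z, hz, hz2⟩ := (((frequently_ae_mem_iff).2 hnC).and_eventually h).exists
    have e5 := h5 z
    have e6 := h6 z
    have e2 := h2 z
    simp only [Pi.zero_apply] at hz2
    have : m.real (Iic z) = 0 := by linarith
    rw [measureReal_eq_zero_iff] at this
    exact hmB (measure_mono_null (fun b hb => hBC b hb z hz) this)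
  · have h : ∫ z, (1 - ((m (Set.Iio z)).toReal + (1 / 2) * (m {z}).toReal)) ∂n = 0 := by
      rw [integral_sub (integrable_const _) hi]
      simp only [relEffect, mem_singleton_iff] at h
      rw [h]; simp
    rw [integral_eq_zero_iff_of_nonneg (f := fun z => 1 - ((m (Set.Iio z)).toReal + (1 / 2) * (m {z}).toReal))
      (fun z => by
        have := h5 z; have := h6 z; have := h2 z; have := h4 z
        simp only [Pi.zero_apply]; linarith) ((integrable_const _).sub hi)] at h
    obtain ⟨z, hz, hz2⟩ := (((frequently_ae_mem_iff).2 hnB).and_eventually h).exists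
    have e5 := h5 z
    have e6 := h6 z
    have e2 := h2 z
    have e4 := h4 z
    simp only [Pi.zero_apply] at hz2
    have : m.real (Iio z) = 1 := by simp only [Measure.real] at *; linarith
    have h7 : m.real (Iio z)ᶜ = 0 := by
      rw [probReal_compl_eq_one_sub measurableSet_Iio, this]; simp
    rw [measureReal_eq_zero_iff] at h7
    exact hmC (measure_mono_null (fun b hb => by simpa using hBC z hz b hb) h7)

lemma aux_rel_one (m n : Measure ℝ) [IsProbabilityMeasure m] [IsProbabilityMeasure n]
    (B : Set ℝ) (hB : IsLowerSet B) (hmB : m B = 1) (hnB : n B = 0) : relEffect m n = 1 := by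
  obtain ⟨hm, h2, hi⟩ := aux_integrand m
  have : (fun z => (m (Set.Iio z)).toReal + (1 / 2) * (m {z}).toReal) =ᵐ[n] fun _ => 1 := by
    have hz : ∀ᵐ z ∂n, z ∉ B := measure_eq_zero_iff_ae_notMem.1 hnB
    filter_upwards [hz] with z hz
    have hsub : B ⊆ Iio z := fun b hb => by
      by_contra hlt
      exact hz (hB (not_lt.1 hlt) hb)
    have h1 : m (Iio z) = 1 := le_antisymm prob_le_one (hmB ▸ measure_mono hsub)
    have e2 := h2 z
    have e4 : m.real (Iic z) ≤ 1 := measureReal_le_one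
    have h6 : 0 ≤ (m {z}).toReal := ENNReal.toReal_nonneg
    rw [h1] at e2 ⊢
    simp only [ENNReal.toReal_one] at *
    linarith
  rw [relEffect, integral_congr_ae this]; simp

lemma aux_rel_zero (m n : Measure ℝ) [IsProbabilityMeasure m] [IsProbabilityMeasure n]
    (B : Set ℝ) (hBm : MeasurableSet B) (hB : IsLowerSet B) (hmB : m B = 0) (hnB : n B = 1) :
    relEffect m n = 0 := by
  have : (fun z => (m (Set.Iio z)).toReal + (1 / 2) * (m {z}).toReal) =ᵐ[n] fun _ => 0 := by
    have hz : ∀ᵐ z ∂n, z ∈ B := (mem_ae_iff_prob_eq_one hBm).2 hnB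
    filter_upwards [hz] with z hz
    have h1 : m (Iio z) = 0 := measure_mono_null (fun b hb => hB (le_of_lt hb) hz) hmB
    have h3 : m {z} = 0 := measure_mono_null (by simpa using hz) hmB
    simp [h1, h3]
  rw [relEffect, integral_congr_ae this]; simp

section
variable {E : Type*} [MeasurableSpace E]

lemma aux_sep_null [MeasurableSingletonClass E] (P : Measure E) [IsProbabilityMeasure P]
    (hP : ∀ x, P {x} = 0) (κ : Kernel E ℝ) [IsMarkovKernel κ]
    (h : ∀ᵐ q ∂(P.prod P), q.1 ≠ q.2 → relEffect (κ q.1) (κ q.2) ∈ ({0, 1} : Set ℝ))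
    (B C : Set ℝ) (hBC : ∀ b ∈ B, ∀ c ∈ C, b ≤ c) :
    ∀ᵐ x ∂P, κ x B = 0 ∨ κ x C = 0 := by
  have h2 := Measure.ae_ae_of_ae_prod h
  by_contra hcon
  have hf : ∃ᵐ x ∂P, ¬ (κ x B = 0 ∨ κ x C = 0) := Filter.not_eventually.1 hcon
  obtain ⟨x, hx, hx2⟩ := (hf.and_eventually h2).exists
  have hne : ∀ᵐ y ∂P, x ≠ y := by
    have := measure_eq_zero_iff_ae_notMem.1 (hP x)
    filter_upwards [this] with y hy h
    exact hy (by simp [h])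
  obtain ⟨y, ⟨hy, hy2⟩, hy3⟩ := ((hf.and_eventually hx2).and_eventually hne).exists
  push Not at hx hy
  exact aux_rel_false _ _ (hy2 hy3) B C hBC hx.1 hx.2 hy.1 hy.2

lemma aux_backward (P : Measure E) [IsProbabilityMeasure P] (κ : Kernel E ℝ) [IsMarkovKernel κ]
    (F : ℝ → ℝ) (hF : Monotone F) (hF01 : ∀ y, F y ∈ Icc (0:ℝ) 1)
    (h0 : ∀ c, ∀ᵐ x ∂P, κ x {y | F y = c} = 0)
    (h01 : ∀ u ∈ Icc (0:ℝ) 1, ∀ᵐ x ∂P, κ x {y | F y ≤ u} = 0 ∨ κ x {y | F y ≤ u} = 1) :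
    ∀ᵐ q ∂(P.prod P), relEffect (κ q.1) (κ q.2) ∈ ({0, 1} : Set ℝ) := by
  have hBm : ∀ u, MeasurableSet {y | F y ≤ u} := fun u => measurableSet_le hF.measurable measurable_const
  have hBl : ∀ u, IsLowerSet {y | F y ≤ u} := fun u a b hab ha => (hF hab).trans ha
  have hr : ∀ᵐ x ∂P, ∀ r : ℚ, (r:ℝ) ∈ Icc (0:ℝ) 1 →
      κ x {y | F y ≤ r} = 0 ∨ κ x {y | F y ≤ r} = 1 := by
    rw [ae_all_iff]
    intro r
    by_cases hr : (r:ℝ) ∈ Icc (0:ℝ) 1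
    · filter_upwards [h01 r hr] with x hx _ using hx
    · exact Filter.Eventually.of_forall fun x h => absurd h hr
  have hgood : ∀ x, (∀ r : ℚ, (r:ℝ) ∈ Icc (0:ℝ) 1 →
      κ x {y | F y ≤ r} = 0 ∨ κ x {y | F y ≤ r} = 1) → ∀ᵐ z ∂(κ x), ∀ r : ℚ, (r:ℝ) ∈ Icc (0:ℝ) 1 →
      (F z ≤ r ∧ κ x {y | F y ≤ r} = 1) ∨ (¬ F z ≤ r ∧ κ x {y | F y ≤ r} = 0) := by
    intro x hx
    rw [ae_all_iff]
    intro r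
    by_cases hr : (r:ℝ) ∈ Icc (0:ℝ) 1
    · rcases hx r hr with h | h
      · filter_upwards [measure_eq_zero_iff_ae_notMem.1 h] with z hz _
        exact Or.inr ⟨hz, h⟩
      · filter_upwards [(mem_ae_iff_prob_eq_one (hBm r)).2 h] with z hz _
        exact Or.inl ⟨hz, h⟩
    · exact Filter.Eventually.of_forall fun x h => absurd h hr
  have key : ∀ᵐ q ∂(P.prod P), ∃ r : ℚ, (κ q.1 {y | F y ≤ r} = 1 ∧ κ q.2 {y | F y ≤ r} = 0) ∨
      (κ q.1 {y | F y ≤ r} = 0 ∧ κ q.2 {y | F y ≤ r} = 1) := by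
    have hk : ∀ r : ℚ, Measurable fun x => κ x {y | F y ≤ r} := fun r => κ.measurable_coe (hBm r)
    rw [Measure.ae_prod_iff_ae_ae]
    · filter_upwards [hr] with x hx
      obtain ⟨z, hz⟩ := (hgood x hx).exists
      filter_upwards [hr, h0 (F z)] with x' hx' hx0
      obtain ⟨w, hw, hwz⟩ := ((hgood x' hx').and (measure_eq_zero_iff_ae_notMem.1 hx0)).exists
      have hwz : F w ≠ F z := hwz
      rcases lt_or_gt_of_ne hwz with hlt | hlt
      · obtain ⟨r, hr1, hr2⟩ := exists_rat_btwn hlt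
        have hri : (r:ℝ) ∈ Icc (0:ℝ) 1 := ⟨(hF01 w).1.trans hr1.le, hr2.le.trans (hF01 z).2⟩
        refine ⟨r, Or.inr ⟨?_, ?_⟩⟩
        · rcases hz r hri with h | h
          · linarith [h.1]
          · exact h.2
        · rcases hw r hri with h | h
          · exact h.2
          · exact absurd hr1.le h.1
      · obtain ⟨r, hr1, hr2⟩ := exists_rat_btwn hlt
        have hri : (r:ℝ) ∈ Icc (0:ℝ) 1 := ⟨(hF01 z).1.trans hr1.le, hr2.le.trans (hF01 w).2⟩
        refine ⟨r, Or.inl ⟨?_, ?_⟩⟩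
        · rcases hz r hri with h | h
          · exact h.2
          · exact absurd hr1.le h.1
        · rcases hw r hri with h | h
          · linarith [h.1]
          · exact h.2
    · simp only [ofPred_exists]
      refine MeasurableSet.iUnion fun r => ?_
      have m1 : Measurable fun q : E × E => κ q.1 {y | F y ≤ r} := (hk r).comp measurable_fst
      have m2 : Measurable fun q : E × E => κ q.2 {y | F y ≤ r} := (hk r).comp measurable_snd
      exact ((m1 (measurableSet_singleton 1)).inter (m2 (measurableSet_singleton 0))).union
        ((m1 (measurableSet_singleton 0)).inter (m2 (measurableSet_singleton 1)))
  filter_upwards [key] with q ⟨r, hq⟩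
  rcases hq with h | h
  · exact Or.inr (aux_rel_one _ _ _ (hBl r) h.1 h.2)
  · exact Or.inl (aux_rel_zero _ _ _ (hBm r) (hBl r) h.1 h.2)
end

lemma aux_joint {Ω E : Type*} [MeasurableSpace Ω] [StandardBorelSpace Ω] [Nonempty Ω]
    [MeasurableSpace E] (μ : Measure Ω) [IsProbabilityMeasure μ]
    (X : Ω → E) (Y Y' : Ω → ℝ) (hX : Measurable X) (hY : Measurable Y) (hY' : Measurable Y')
    (hcopy : IsCondIndepCopy μ X hX Y Y') (B C : Set ℝ) (hB : MeasurableSet B)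
    (hC : MeasurableSet C) :
    μ {ω | Y ω ∈ B ∧ Y' ω ∈ C} = ∫⁻ x, condDistrib Y X μ x B * condDistrib Y X μ x C ∂(μ.map X) := by
  obtain ⟨h1, h2⟩ := hcopy
  have h3 := (condIndepFun_iff_map_prod_eq_prod_condDistrib_prod_condDistrib hY hY' hX).1 h2
  have h4 := congrArg (fun m => m (univ ×ˢ (B ×ˢ C))) h3
  have hm : MeasurableSet ((univ : Set E) ×ˢ (B ×ˢ C)) := MeasurableSet.univ.prod (hB.prod hC)
  rw [Measure.map_apply (by fun_prop) hm, Measure.bind_apply hm (by fun_prop)] at h4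
  have : (fun ω ↦ (X ω, Y ω, Y' ω)) ⁻¹' univ ×ˢ B ×ˢ C = {ω | Y ω ∈ B ∧ Y' ω ∈ C} := by
    ext; simp
  rw [this] at h4
  rw [h4]
  apply lintegral_congr_ae
  filter_upwards [h1] with x hx
  rw [Kernel.prod_apply_prod, Kernel.prod_apply_prod, hx]
  simp

lemma aux_marg {Ω E : Type*} [MeasurableSpace Ω]
    [MeasurableSpace E] (μ : Measure Ω) [IsProbabilityMeasure μ]
    (X : Ω → E) (Y : Ω → ℝ) (hX : Measurable X) (hY : Measurable Y) (B : Set ℝ)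
    (hB : MeasurableSet B) :
    (μ.map Y) B = ∫⁻ x, condDistrib Y X μ x B ∂(μ.map X) := by
  rw [← condDistrib_comp_map hX.aemeasurable hY.aemeasurable, Measure.bind_apply hB (by fun_prop)]

/-- Suppose at least one coordinate of `X` has a continuous distribution function and let
`(F_Y(Y), F_Y(Y'))` be the Markov product of `(X, F_Y(Y))`.  Then `{z : ℙ(X = z) > 0} = ∅`
and `Y` is completely separated relative to `X` iff
`ℙ(F_Y(Y) ≤ u, F_Y(Y') ≤ v) = min{u, v}` for all `(u, v) ∈ [0,1]²`, i.e. iff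
`(F_Y(Y), F_Y(Y'))` admits an ordinal sum structure of size `0`. -/
theorem completely_separated_iff_comonotone_of_continuous_coordinate {Ω : Type*}
    [MeasurableSpace Ω] [StandardBorelSpace Ω] [Nonempty Ω] {p : ℕ}
    (μ : Measure Ω) [IsProbabilityMeasure μ]
    (X : Ω → (Fin p → ℝ)) (Y Y' : Ω → ℝ)
    (hX : Measurable X) (hY : Measurable Y) (hY' : Measurable Y')
    (hcont : ∃ i : Fin p, Continuous fun t : ℝ => (μ {ω | X ω i ≤ t}).toReal)
    (hcopy : IsCondIndepCopy μ X hX Y Y') :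
    {z : Fin p → ℝ | 0 < μ.map X {z}} = ∅ ∧
    (CompletelySeparated μ X Y ↔
      ∀ u ∈ Set.Icc (0 : ℝ) 1, ∀ v ∈ Set.Icc (0 : ℝ) 1,
        (μ {ω | distFun μ Y (Y ω) ≤ u ∧ distFun μ Y (Y' ω) ≤ v}).toReal = min u v) := by
  have hPx : IsProbabilityMeasure (μ.map X) := Measure.isProbabilityMeasure_map hX.aemeasurable
  have hPy : IsProbabilityMeasure (μ.map Y) := Measure.isProbabilityMeasure_map hY.aemeasurable
  have hatom : ∀ z, μ.map X {z} = 0 := by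
    obtain ⟨i, hi⟩ := hcont
    have hXi : Measurable fun ω => X ω i := (measurable_pi_apply i).comp hX
    have hPi : IsProbabilityMeasure (μ.map fun ω => X ω i) :=
      Measure.isProbabilityMeasure_map hXi.aemeasurable
    have hc : Continuous (cdf (μ.map fun ω => X ω i)) := by
      convert hi using 2 with t
      rw [cdf_eq_real, Measure.real, Measure.map_apply hXi measurableSet_Iic]
      rfl
    intro z
    have h1 := (aux_cdf_cont_iff _).1 hc (z i)
    rw [Measure.map_apply hXi (measurableSet_singleton _)] at h1
    rw [Measure.map_apply hX (measurableSet_singleton _)]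
    refine measure_mono_null (fun ω hω => ?_) h1
    have hω : X ω = z := hω
    show X ω i = z i
    rw [hω]
  refine ⟨by ext z; simp [hatom z], ?_⟩
  have hFeq : distFun μ Y = cdf (μ.map Y) := by
    funext t
    rw [cdf_eq_real, Measure.real, Measure.map_apply hY measurableSet_Iic]
    rfl
  set κ := condDistrib Y X μ with hκ
  set F := cdf (μ.map Y) with hF
  rw [hFeq]
  have hBm : ∀ u, MeasurableSet {y | F y ≤ u} :=
    fun u => measurableSet_le F.mono.measurable measurable_const
  have hJ : ∀ u v, μ {ω | F (Y ω) ≤ u ∧ F (Y' ω) ≤ v}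
      = ∫⁻ x, κ x {y | F y ≤ u} * κ x {y | F y ≤ v} ∂(μ.map X) := fun u v =>
    aux_joint μ X Y Y' hX hY hY' hcopy {y | F y ≤ u} {y | F y ≤ v} (hBm u) (hBm v)
  have hM := fun B hB => aux_marg μ X Y hX hY B hB
  constructor
  · intro hsep
    have hnull := aux_sep_null (μ.map X) hatom κ hsep
    have hYatom : ∀ a, μ.map Y {a} = 0 := by
      intro a
      rw [hM _ (measurableSet_singleton a), lintegral_eq_zero_iff (κ.measurable_coe (measurableSet_singleton a))]
      filter_upwards [hnull {a} {a} (by simp)] with x hx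
      simpa using hx
    have h01 : ∀ u, ∀ᵐ x ∂(μ.map X), κ x {y | F y ≤ u} = 0 ∨ κ x {y | F y ≤ u} = 1 := by
      intro u
      filter_upwards [hnull {y | F y ≤ u} {y | F y ≤ u}ᶜ (fun b hb c hc => by
        by_contra hlt
        exact hc ((F.mono (not_le.1 hlt).le).trans hb))] with x hx
      rcases hx with h | h
      · exact Or.inl h
      · exact Or.inr ((prob_compl_eq_zero_iff (hBm u)).1 h)
    have main : ∀ u ∈ Icc (0:ℝ) 1, ∀ v, u ≤ v →
        (∫⁻ x, κ x {y | F y ≤ u} * κ x {y | F y ≤ v} ∂(μ.map X)).toReal = u := by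
      intro u hu v huv
      have hun : ((μ.map Y) {y | F y ≤ u}).toReal = u := aux_uniform (μ.map Y) hYatom u hu
      refine Eq.trans ?_ hun
      rw [hM _ (hBm u)]
      congr 1
      apply lintegral_congr_ae
      filter_upwards [h01 u, h01 v] with x hx hx2
      have hle : κ x {y | F y ≤ u} ≤ κ x {y | F y ≤ v} :=
        measure_mono (fun y hy => le_trans hy huv)
      rcases hx with h | h
      · change κ x {y | F y ≤ u} * κ x {y | F y ≤ v} = κ x {y | F y ≤ u}
        rw [h, zero_mul]
      · rcases hx2 with h2 | h2
        · rw [h, h2] at hle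
          simp at hle
        · change κ x {y | F y ≤ u} * κ x {y | F y ≤ v} = κ x {y | F y ≤ u}
          rw [h2, mul_one]
    intro u hu v hv
    rw [hJ]
    rcases le_total u v with h | h
    · rw [min_eq_left h, main u hu v h]
    · rw [min_eq_right h]
      refine Eq.trans ?_ (main v hv u h)
      simp only [mul_comm]
  · intro hmin
    have hU : ∀ u ∈ Icc (0:ℝ) 1, (μ.map Y).real {y | F y ≤ u} = u := by
      intro u hu
      have h := hmin u hu 1 (by simp)
      rw [min_eq_left hu.2] at h
      rw [Measure.real, Measure.map_apply hY (hBm u)]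
      refine Eq.trans ?_ h
      congr 2
      ext ω
      simp [hF, cdf_le_one]
    have h01 : ∀ u ∈ Icc (0:ℝ) 1, ∀ᵐ x ∂(μ.map X),
        κ x {y | F y ≤ u} = 0 ∨ κ x {y | F y ≤ u} = 1 := by
      intro u hu
      have hk : Measurable fun x => κ x {y | F y ≤ u} := κ.measurable_coe (hBm u)
      have h := hmin u hu u hu
      rw [min_self, hJ] at h
      have h := h.trans (hU u hu).symm
      rw [Measure.real] at h
      have hfin : ∫⁻ x, κ x {y | F y ≤ u} ∂(μ.map X) ≠ ⊤ := by
        rw [← hM _ (hBm u)]; exact measure_ne_top _ _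
      have hle : ∀ x, κ x {y | F y ≤ u} * κ x {y | F y ≤ u} ≤ κ x {y | F y ≤ u} := fun x =>
        mul_le_of_le_one_right (zero_le) prob_le_one
      have hfin2 : ∫⁻ x, κ x {y | F y ≤ u} * κ x {y | F y ≤ u} ∂(μ.map X) ≠ ⊤ :=
        ne_top_of_le_ne_top hfin (lintegral_mono hle)
      rw [hM _ (hBm u), ENNReal.toReal_eq_toReal_iff' hfin2 hfin] at h
      have := ae_eq_of_ae_le_of_lintegral_le (Filter.Eventually.of_forall hle) hfin2
        hk.aemeasurable h.ge
      filter_upwards [this] with x hx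
      by_cases h0 : κ x {y | F y ≤ u} = 0
      · exact Or.inl h0
      · right
        have hx' : κ x {y | F y ≤ u} * κ x {y | F y ≤ u} = κ x {y | F y ≤ u} * 1 := by
          rw [mul_one]; exact hx
        exact (ENNReal.mul_right_inj h0 (measure_ne_top _ _)).1 hx'
    have hF01 : ∀ y, F y ∈ Icc (0:ℝ) 1 := fun y => ⟨cdf_nonneg _ y, cdf_le_one _ y⟩
    have h0 : ∀ c, ∀ᵐ x ∂(μ.map X), κ x {y | F y = c} = 0 := by
      intro c
      have hms : MeasurableSet {y | F y = c} :=
        measurableSet_eq_fun F.mono.measurable measurable_const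
      have h1 : (μ.map Y) {y | F y = c} = 0 := by
        by_cases hc : c ∈ Icc (0:ℝ) 1
        · rw [← measureReal_eq_zero_iff]
          apply le_antisymm _ measureReal_nonneg
          apply le_of_forall_pos_le_add
          intro e he
          rw [zero_add]
          by_cases hce : c - e ∈ Icc (0:ℝ) 1
          · have hd : Disjoint {y | F y = c} {y | F y ≤ c - e} := by
              rw [Set.disjoint_left]
              intro y hy hy2
              have hy : F y = c := hy
              have hy2 : F y ≤ c - e := hy2
              linarith
            have h2 := measureReal_union (μ := μ.map Y) hd (hBm (c - e))
            have h3 : (μ.map Y).real ({y | F y = c} ∪ {y | F y ≤ c - e})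
                ≤ (μ.map Y).real {y | F y ≤ c} := by
              refine measureReal_mono ?_
              rintro y (hy | hy)
              · exact le_of_eq hy
              · have hy : F y ≤ c - e := hy
                show F y ≤ c
                linarith
            rw [hU c hc] at h3
            rw [hU _ hce] at h2
            linarith
          · have : c ≤ e := by
              by_contra hlt
              exact hce ⟨by linarith, by linarith [hc.2]⟩
            calc (μ.map Y).real {y | F y = c} ≤ (μ.map Y).real {y | F y ≤ c} :=
                  measureReal_mono (fun y hy => le_of_eq hy)
              _ = c := hU c hc
              _ ≤ e := this
        · have : {y | F y = c} = ∅ := by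
            ext y
            simp only [mem_ofPred_eq, mem_empty_iff_false, iff_false]
            intro h
            exact hc (h ▸ hF01 y)
          rw [this]; simp
      rw [hM _ hms, lintegral_eq_zero_iff (κ.measurable_coe hms)] at h1
      exact h1
    have := aux_backward (μ.map X) κ F F.mono hF01 h0 h01
    exact this.mono fun q hq _ => hq
end

section
/- Let X be uniformly distributed on [−1,0] ∪ [1,3] and Y = 3·1_{{X ≥ 1}} − 1. Then Y perfectly depends on X (Y is a measurable function of X), but Y is not completely separated relative to X: for (ℙ^X ⊗ ℙ^X)-almost all pairs (x₁,x₂) with x₁, x₂ ∈ [−1,0] and x₁ ≠ x₂ one has Ψ(ℙ^{Y|X=x₁}, ℙ^{Y|X=x₂}) = 1/2 ∉ {0,1}, and such pairs have positive (ℙ^X ⊗ ℙ^X)-measure. -/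
open MeasureTheory ProbabilityTheory Set
open scoped ENNReal

/-- Let `X` be uniformly distributed on `[−1,0] ∪ [1,3]` and `Y = 3·1_{X ≥ 1} − 1`.
Then `Y` perfectly depends on `X`, but `Y` is not completely separated relative to `X`:
for `(ℙ^X ⊗ ℙ^X)`-almost all pairs `(x₁, x₂)` with `x₁, x₂ ∈ [−1,0]` and `x₁ ≠ x₂` one has
`Ψ(ℙ^{Y|X=x₁}, ℙ^{Y|X=x₂}) = 1/2 ∉ {0,1}`, and such pairs have positive
`(ℙ^X ⊗ ℙ^X)`-measure. -/
theorem perfect_dependence_not_completely_separated {Ω : Type*} [MeasurableSpace Ω]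
    (μ : Measure Ω) [IsProbabilityMeasure μ] (X Y : Ω → ℝ)
    (hX : Measurable X) (hY : Measurable Y)
    (hXdist : μ.map X
      = (3 : ℝ≥0∞)⁻¹ • volume.restrict (Set.Icc (-1 : ℝ) 0 ∪ Set.Icc 1 3))
    (hYdef : Y = fun ω => 3 * Set.indicator (Set.Ici (1 : ℝ)) (fun _ => (1 : ℝ)) (X ω) - 1) :
    (∃ f : ℝ → ℝ, Measurable f ∧ Y =ᵐ[μ] fun ω => f (X ω)) ∧
    ¬ CompletelySeparated μ X Y ∧
    (∀ᵐ q ∂((μ.map X).prod (μ.map X)),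
      (q.1 ∈ Set.Icc (-1 : ℝ) 0 ∧ q.2 ∈ Set.Icc (-1 : ℝ) 0 ∧ q.1 ≠ q.2) →
        relEffect (condDistrib Y X μ q.1) (condDistrib Y X μ q.2) = 1 / 2) ∧
    (1 / 2 : ℝ) ∉ ({0, 1} : Set ℝ) ∧
    0 < ((μ.map X).prod (μ.map X))
        {q : ℝ × ℝ | q.1 ∈ Set.Icc (-1 : ℝ) 0 ∧ q.2 ∈ Set.Icc (-1 : ℝ) 0 ∧ q.1 ≠ q.2} := by
  set f : ℝ → ℝ := fun x => 3 * Set.indicator (Set.Ici (1 : ℝ)) (fun _ => (1 : ℝ)) x - 1 with hf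
  have hfm : Measurable f :=
    ((measurable_const.indicator measurableSet_Ici).const_mul 3).sub_const 1
  have hYf : Y = f ∘ X := hYdef
  have hcd : condDistrib Y X μ =ᵐ[μ.map X] Kernel.deterministic f hfm := by
    rw [hYf]
    exact condDistrib_comp_self X hfm
  have hprob : IsProbabilityMeasure (μ.map X) := Measure.isProbabilityMeasure_map hX.aemeasurable
  have h1 : ∀ᵐ q ∂((μ.map X).prod (μ.map X)),
      condDistrib Y X μ q.1 = Kernel.deterministic f hfm q.1 :=
    Measure.quasiMeasurePreserving_fst.ae hcd
  have h2 : ∀ᵐ q ∂((μ.map X).prod (μ.map X)),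
      condDistrib Y X μ q.2 = Kernel.deterministic f hfm q.2 :=
    Measure.quasiMeasurePreserving_snd.ae hcd
  have hhalf : (1 / 2 : ℝ) ∉ ({0, 1} : Set ℝ) := by norm_num
  have hmain : ∀ᵐ q ∂((μ.map X).prod (μ.map X)),
      (q.1 ∈ Set.Icc (-1 : ℝ) 0 ∧ q.2 ∈ Set.Icc (-1 : ℝ) 0 ∧ q.1 ≠ q.2) →
        relEffect (condDistrib Y X μ q.1) (condDistrib Y X μ q.2) = 1 / 2 := by
    filter_upwards [h1, h2] with q e1 e2 ⟨m1, m2, _⟩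
    have hv : ∀ x ∈ Set.Icc (-1 : ℝ) 0, f x = -1 := by
      intro x hx
      have : x ∉ Set.Ici (1 : ℝ) := by
        simp only [Set.mem_Ici, not_le]
        linarith [hx.2]
      simp [hf, Set.indicator_of_notMem this]
    rw [e1, e2, Kernel.deterministic_apply, Kernel.deterministic_apply, hv _ m1, hv _ m2,
      relEffect, integral_dirac]
    simp
  have hpos : 0 < ((μ.map X).prod (μ.map X))
        {q : ℝ × ℝ | q.1 ∈ Set.Icc (-1 : ℝ) 0 ∧ q.2 ∈ Set.Icc (-1 : ℝ) 0 ∧ q.1 ≠ q.2} := by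
    have hsub : Set.Icc (-1 : ℝ) (-1/2) ×ˢ Set.Ioc (-1/2 : ℝ) 0 ⊆
        {q : ℝ × ℝ | q.1 ∈ Set.Icc (-1 : ℝ) 0 ∧ q.2 ∈ Set.Icc (-1 : ℝ) 0 ∧ q.1 ≠ q.2} := by
      rintro ⟨a, b⟩ ⟨⟨ha1, ha2⟩, ⟨hb1, hb2⟩⟩
      simp only at ha1 ha2 hb1 hb2
      exact ⟨⟨ha1, by simp only; linarith⟩, ⟨by simp only; linarith, hb2⟩,
        by simp only; linarith⟩
    refine lt_of_lt_of_le ?_ (measure_mono hsub)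
    have key : ∀ s : Set ℝ, MeasurableSet s → s ⊆ Set.Icc (-1 : ℝ) 0 → 0 < volume s →
        0 < (μ.map X) s := by
      intro s hs hss hvs
      rw [hXdist, Measure.smul_apply, Measure.restrict_apply hs,
        Set.inter_eq_left.mpr (hss.trans Set.subset_union_left), smul_eq_mul]
      exact ENNReal.mul_pos (by simp) hvs.ne'
    rw [Measure.prod_prod]
    refine ENNReal.mul_pos (key _ measurableSet_Icc ?_ ?_).ne' (key _ measurableSet_Ioc ?_ ?_).ne'
    · exact Set.Icc_subset_Icc le_rfl (by norm_num)
    · rw [Real.volume_Icc]; norm_num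
    · exact Set.Ioc_subset_Icc_self.trans (Set.Icc_subset_Icc (by norm_num) le_rfl)
    · rw [Real.volume_Ioc]; norm_num
  refine ⟨⟨f, hfm, by rw [hYf]; rfl⟩, ?_, hmain, hhalf, hpos⟩
  intro hcs
  refine hpos.ne' ?_
  rw [CompletelySeparated] at hcs
  refine measure_mono_null ?_ (ae_iff.mp (hcs.and hmain))
  intro q hq hcon
  have := hcon.1 hq.2.2
  rw [hcon.2 hq] at this
  exact hhalf this
end

section
/- Let X take values in {−1,1} with ℙ(X = −1) = 1/3, and let Y have conditional distributions ℙ^{Y|X=−1} = Uniform([−1,0]) and ℙ^{Y|X=1} equal to the mixture ½·Uniform([1,3]) + ½·δ₁ (point mass at 1). Then Y is completely separated relative to X (indeed Ψ(ℙ^{Y|X=−1}, ℙ^{Y|X=1}) = 1), but Y does not perfectly depend on X: there is no measurable function f with Y = f(X) almost surely. -/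
open MeasureTheory ProbabilityTheory Set
open scoped ENNReal

/-- Let `ℙ(X = −1) = 1/3`, `ℙ(X = 1) = 2/3`, with conditional distributions
`ℙ^{Y|X=−1} = Uniform([−1,0])` and `ℙ^{Y|X=1} = ½·Uniform([1,3]) + ½·δ₁`.  Then `Y` is
completely separated relative to `X` (indeed `Ψ(ℙ^{Y|X=−1}, ℙ^{Y|X=1}) = 1`), but `Y` does
not perfectly depend on `X`: there is no measurable `f` with `Y = f(X)` a.s. -/
theorem completely_separated_not_perfectly_dependent {Ω : Type*} [MeasurableSpace Ω]
    (μ : Measure Ω) [IsProbabilityMeasure μ] (X Y : Ω → ℝ)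
    (hX : Measurable X) (hY : Measurable Y)
    (hXm1 : μ.map X {-1} = 3⁻¹) (hX1 : μ.map X {1} = 2 / 3)
    (hcondm1 : condDistrib Y X μ (-1) = volume.restrict (Set.Icc (-1 : ℝ) 0))
    (hcond1 : condDistrib Y X μ 1
      = (2 : ℝ≥0∞)⁻¹ • ((2 : ℝ≥0∞)⁻¹ • volume.restrict (Set.Icc (1 : ℝ) 3))
        + (2 : ℝ≥0∞)⁻¹ • Measure.dirac (1 : ℝ)) :
    CompletelySeparated μ X Y ∧
    relEffect (condDistrib Y X μ (-1)) (condDistrib Y X μ 1) = 1 ∧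
    ¬ ∃ f : ℝ → ℝ, Measurable f ∧ Y =ᵐ[μ] fun ω => f (X ω) := by
  set P := condDistrib Y X μ (-1) with hP
  set Q := condDistrib Y X μ 1 with hQ
  have hPp : IsProbabilityMeasure P := by rw [hP]; infer_instance
  have hQp : IsProbabilityMeasure Q := by rw [hQ]; infer_instance
  have hP0 : P (Set.Ioi 0) = 0 := by
    rw [hcondm1, Measure.restrict_apply measurableSet_Ioi]
    have : Set.Ioi (0:ℝ) ∩ Set.Icc (-1) 0 = ∅ := by
      ext x; simp only [mem_inter_iff, mem_Ioi, mem_Icc, mem_empty_iff_false, iff_false]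
      rintro ⟨h, _, h'⟩; linarith
    simp [this]
  have hQ0 : Q (Set.Iio 1) = 0 := by
    have : Set.Iio (1:ℝ) ∩ Set.Icc 1 3 = ∅ := by
      ext x; simp only [mem_inter_iff, mem_Iio, mem_Icc, mem_empty_iff_false, iff_false]
      rintro ⟨h, h', _⟩; linarith
    rw [hcond1]
    simp [Measure.restrict_apply measurableSet_Iio, this]
  have hPae : ∀ᵐ z ∂P, z ≤ 0 := by
    rw [ae_iff]; convert hP0 using 2; ext x; simp
  have hQae : ∀ᵐ z ∂Q, 1 ≤ z := by
    rw [ae_iff]; convert hQ0 using 2; ext x; simp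
  have h1 : relEffect P Q = 1 := by
    unfold relEffect
    have : (fun z => (P (Set.Iio z)).toReal + (1 / 2) * (P {z}).toReal) =ᵐ[Q] fun _ => 1 := by
      filter_upwards [hQae] with z hz
      have a : P (Set.Iio z) = 1 := by
        rw [prob_compl_eq_zero_iff measurableSet_Iio |>.symm]
        refine measure_mono_null (fun x hx => ?_) hP0
        simp at hx ⊢; linarith
      have b : P {z} = 0 := by
        refine measure_mono_null (fun x hx => ?_) hP0
        simp at hx ⊢; linarith
      simp [a, b]
    rw [integral_congr_ae this]; simp
  have h2 : relEffect Q P = 0 := by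
    unfold relEffect
    have : (fun z => (Q (Set.Iio z)).toReal + (1 / 2) * (Q {z}).toReal) =ᵐ[P] fun _ => 0 := by
      filter_upwards [hPae] with z hz
      have a : Q (Set.Iio z) = 0 := by
        refine measure_mono_null (fun x hx => ?_) hQ0
        simp at hx ⊢; linarith
      have b : Q {z} = 0 := by
        refine measure_mono_null (fun x hx => ?_) hQ0
        simp at hx ⊢; linarith
      simp [a, b]
    rw [integral_congr_ae this]; simp
  have : IsProbabilityMeasure (μ.map X) := Measure.isProbabilityMeasure_map hX.aemeasurable
  refine ⟨?_, h1, ?_⟩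
  · have hx : ∀ᵐ x ∂(μ.map X), x = -1 ∨ x = 1 := by
      have hm : MeasurableSet ({-1, 1} : Set ℝ) := by measurability
      have : μ.map X ({-1, 1} : Set ℝ) = 1 := by
        rw [Set.insert_eq, measure_union (by norm_num) (measurableSet_singleton _), hXm1, hX1,
          ← one_div, ENNReal.div_add_div_same]
        norm_num
        exact ENNReal.div_self (by norm_num) (by norm_num)
      have := (prob_compl_eq_zero_iff hm).2 this
      rw [ae_iff]; convert this using 2; ext x; simp
    unfold CompletelySeparated
    have e1 := Measure.quasiMeasurePreserving_fst (μ := μ.map X) (ν := μ.map X) |>.ae hx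
    have e2 := Measure.quasiMeasurePreserving_snd (μ := μ.map X) (ν := μ.map X) |>.ae hx
    filter_upwards [e1, e2] with q a b hne
    rcases a with a | a <;> rcases b with b | b <;> rw [a, b] at hne ⊢
    · exact absurd rfl hne
    · right; exact h1
    · left; exact h2
    · exact absurd rfl hne
  · rintro ⟨f, hf, hYf⟩
    have e : condDistrib Y X μ =ᵐ[μ.map X] Kernel.deterministic f hf := by
      rw [condDistrib_congr_left hYf]
      exact condDistrib_comp_self X hf
    have e' : condDistrib Y X μ (-1) = Kernel.deterministic f hf (-1) := by
      by_contra hne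
      have : μ.map X {-1} = 0 := measure_mono_null (by
        intro x hx; rw [mem_singleton_iff] at hx; subst hx; exact hne) (ae_iff.1 e)
      rw [hXm1] at this
      simp at this
    have z : P {f (-1)} = 1 := by
      rw [hP, e', Kernel.deterministic_apply]; simp
    rw [hcondm1] at z
    simp at z
end
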